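/- For every countable model (M,𝒳) of BΣ2^0 + WKL0 there is a proper end extension (K,𝒳) of (M,𝒳) (with the same second-order part, injected) such that (M,𝒳) ≼_{Σ2^0} (K,𝒳) and (K,𝒳) ⊨ BΣ1^0. -/

import Mathlib

namespace PaperArith

/-! ## Syntax of (two-sorted) first-order arithmetic

Terms and formulas of arithmetic in the language `{0, 1, +, ·, <}`,
with number variables and (monadic second-order) set variables both indexed
by natural numbers.  Bounded quantifiers are taken as primitives, so that the
class `Δ₀` of bounded formulas is a purely syntactic class. -/

/-- Terms of first-order arithmetic in the language `{0, 1, +, ·, <}`. -/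
inductive Term : Type
  | var : ℕ → Term
  | zero : Term
  | one : Term
  | add : Term → Term → Term
  | mul : Term → Term → Term

/-- Formulas of (two-sorted) arithmetic.  `mem t i` is the atomic formula
`t ∈ Xᵢ`; `ball x t φ` is `∀ x < t, φ` and `bex x t φ` is `∃ x < t, φ`;
`sall i φ` and `sex i φ` quantify over the set variable `Xᵢ`.
Purely first-order formulas are those avoiding `mem`, `sall`, `sex`. -/
inductive Fml : Type
  | eq : Term → Term → Fml
  | lt : Term → Term → Fml
  | mem : Term → ℕ → Fml
  | not : Fml → Fml
  | and : Fml → Fml → Fml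
  | or : Fml → Fml → Fml
  | imp : Fml → Fml → Fml
  | all : ℕ → Fml → Fml
  | ex : ℕ → Fml → Fml
  | ball : ℕ → Term → Fml → Fml
  | bex : ℕ → Term → Fml → Fml
  | sall : ℕ → Fml → Fml
  | sex : ℕ → Fml → Fml

/-- A structure for the first-order language of arithmetic. -/
structure Str : Type 1 where
  M : Type
  zero : M
  one : M
  add : M → M → M
  mul : M → M → M
  lt : M → M → Prop

/-- Value of a term under a valuation of the number variables. -/
def tval (S : Str) (v : ℕ → S.M) : Term → S.M
  | .var i => v i
  | .zero => S.zero
  | .one => S.one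
  | .add t u => S.add (tval S v t) (tval S v u)
  | .mul t u => S.mul (tval S v t) (tval S v u)

/-- Update a valuation at one variable. -/
def upd {α : Type} (v : ℕ → α) (x : ℕ) (a : α) : ℕ → α :=
  fun i => if i = x then a else v i

/-- Tarskian satisfaction over the structure `S`, with second-order universe
`X` (set quantifiers range over `X`); `v` is the valuation of number
variables, `w` the valuation of set variables. -/
def Sat (S : Str) (X : Set (Set S.M)) : (ℕ → S.M) → (ℕ → Set S.M) → Fml → Prop
  | v, _, .eq t u => tval S v t = tval S v u
  | v, _, .lt t u => S.lt (tval S v t) (tval S v u)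
  | v, w, .mem t i => tval S v t ∈ w i
  | v, w, .not φ => ¬ Sat S X v w φ
  | v, w, .and φ ψ => Sat S X v w φ ∧ Sat S X v w ψ
  | v, w, .or φ ψ => Sat S X v w φ ∨ Sat S X v w ψ
  | v, w, .imp φ ψ => Sat S X v w φ → Sat S X v w ψ
  | v, w, .all x φ => ∀ m : S.M, Sat S X (upd v x m) w φ
  | v, w, .ex x φ => ∃ m : S.M, Sat S X (upd v x m) w φ
  | v, w, .ball x t φ => ∀ m : S.M, S.lt m (tval S v t) → Sat S X (upd v x m) w φ
  | v, w, .bex x t φ => ∃ m : S.M, S.lt m (tval S v t) ∧ Sat S X (upd v x m) w φ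
  | v, w, .sall i φ => ∀ A : Set S.M, A ∈ X → Sat S X v (upd w i A) φ
  | v, w, .sex i φ => ∃ A : Set S.M, A ∈ X ∧ Sat S X v (upd w i A) φ

/-- First-order satisfaction (for purely first-order formulas the second-order
data is irrelevant). -/
def Sat0 (S : Str) (v : ℕ → S.M) (φ : Fml) : Prop :=
  Sat S ∅ v (fun _ => ∅) φ

/-! ## The arithmetic hierarchy -/

/-- `Δ₀` formulas: purely first-order, only bounded quantifiers. -/
inductive Delta0 : Fml → Prop
  | eq (t u : Term) : Delta0 (.eq t u)
  | lt (t u : Term) : Delta0 (.lt t u)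
  | not {φ : Fml} : Delta0 φ → Delta0 (.not φ)
  | and {φ ψ : Fml} : Delta0 φ → Delta0 ψ → Delta0 (.and φ ψ)
  | or {φ ψ : Fml} : Delta0 φ → Delta0 ψ → Delta0 (.or φ ψ)
  | imp {φ ψ : Fml} : Delta0 φ → Delta0 ψ → Delta0 (.imp φ ψ)
  | ball (x : ℕ) (t : Term) {φ : Fml} : Delta0 φ → Delta0 (.ball x t φ)
  | bex (x : ℕ) (t : Term) {φ : Fml} : Delta0 φ → Delta0 (.bex x t φ)

mutual
  /-- `Σₙ` formulas of the first-order arithmetic hierarchy. -/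
  inductive IsSigma : ℕ → Fml → Prop
    | delta0 {n : ℕ} {φ : Fml} : Delta0 φ → IsSigma n φ
    | ofPi {n : ℕ} {φ : Fml} : IsPi n φ → IsSigma (n + 1) φ
    | ex (x : ℕ) {n : ℕ} {φ : Fml} : IsSigma (n + 1) φ → IsSigma (n + 1) (.ex x φ)
  /-- `Πₙ` formulas of the first-order arithmetic hierarchy. -/
  inductive IsPi : ℕ → Fml → Prop
    | delta0 {n : ℕ} {φ : Fml} : Delta0 φ → IsPi n φ
    | ofSigma {n : ℕ} {φ : Fml} : IsSigma n φ → IsPi (n + 1) φ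
    | all (x : ℕ) {n : ℕ} {φ : Fml} : IsPi (n + 1) φ → IsPi (n + 1) (.all x φ)
end

/-- `Σ₀(Σₙ)`: the closure of `Σₙ` under Boolean operations and bounded
quantification. -/
inductive Sigma0Sigma (n : ℕ) : Fml → Prop
  | ofSigma {φ : Fml} : IsSigma n φ → Sigma0Sigma n φ
  | not {φ : Fml} : Sigma0Sigma n φ → Sigma0Sigma n (.not φ)
  | and {φ ψ : Fml} : Sigma0Sigma n φ → Sigma0Sigma n ψ → Sigma0Sigma n (.and φ ψ)
  | or {φ ψ : Fml} : Sigma0Sigma n φ → Sigma0Sigma n ψ → Sigma0Sigma n (.or φ ψ)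
  | imp {φ ψ : Fml} : Sigma0Sigma n φ → Sigma0Sigma n ψ → Sigma0Sigma n (.imp φ ψ)
  | ball (x : ℕ) (t : Term) {φ : Fml} : Sigma0Sigma n φ → Sigma0Sigma n (.ball x t φ)
  | bex (x : ℕ) (t : Term) {φ : Fml} : Sigma0Sigma n φ → Sigma0Sigma n (.bex x t φ)

/-- The class `Σₙ ∧ Πₙ` of conjunctions of a `Σₙ` and a `Πₙ` formula. -/
def SigmaAndPi (n : ℕ) (φ : Fml) : Prop :=
  ∃ ψ χ : Fml, IsSigma n ψ ∧ IsPi n χ ∧ φ = Fml.and ψ χ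

/-- The class `Σₙ ∨ Πₙ` of disjunctions of a `Σₙ` and a `Πₙ` formula. -/
def SigmaOrPi (n : ℕ) (φ : Fml) : Prop :=
  ∃ ψ χ : Fml, IsSigma n ψ ∧ IsPi n χ ∧ φ = Fml.or ψ χ

/-- `Δ₀⁰` formulas of second-order arithmetic: only bounded first-order
quantifiers; free set variables (set parameters) are allowed. -/
inductive Delta0SO : Fml → Prop
  | eq (t u : Term) : Delta0SO (.eq t u)
  | lt (t u : Term) : Delta0SO (.lt t u)
  | mem (t : Term) (i : ℕ) : Delta0SO (.mem t i)
  | not {φ : Fml} : Delta0SO φ → Delta0SO (.not φ)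
  | and {φ ψ : Fml} : Delta0SO φ → Delta0SO ψ → Delta0SO (.and φ ψ)
  | or {φ ψ : Fml} : Delta0SO φ → Delta0SO ψ → Delta0SO (.or φ ψ)
  | imp {φ ψ : Fml} : Delta0SO φ → Delta0SO ψ → Delta0SO (.imp φ ψ)
  | ball (x : ℕ) (t : Term) {φ : Fml} : Delta0SO φ → Delta0SO (.ball x t φ)
  | bex (x : ℕ) (t : Term) {φ : Fml} : Delta0SO φ → Delta0SO (.bex x t φ)

mutual
  /-- `Σₙ⁰` formulas of the second-order arithmetic hierarchy
  (set parameters allowed, no set quantifiers). -/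
  inductive SigmaSO : ℕ → Fml → Prop
    | delta0 {n : ℕ} {φ : Fml} : Delta0SO φ → SigmaSO n φ
    | ofPi {n : ℕ} {φ : Fml} : PiSO n φ → SigmaSO (n + 1) φ
    | ex (x : ℕ) {n : ℕ} {φ : Fml} : SigmaSO (n + 1) φ → SigmaSO (n + 1) (.ex x φ)
  /-- `Πₙ⁰` formulas of the second-order arithmetic hierarchy. -/
  inductive PiSO : ℕ → Fml → Prop
    | delta0 {n : ℕ} {φ : Fml} : Delta0SO φ → PiSO n φ
    | ofSigma {n : ℕ} {φ : Fml} : SigmaSO n φ → PiSO (n + 1) φ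
    | all (x : ℕ) {n : ℕ} {φ : Fml} : PiSO (n + 1) φ → PiSO (n + 1) (.all x φ)
end

/-! ## First-order theories -/

/-- `PA⁻`: the theory of non-negative parts of discretely ordered rings. -/
structure PAminus (S : Str) : Prop where
  add_assoc : ∀ a b c, S.add (S.add a b) c = S.add a (S.add b c)
  add_comm : ∀ a b, S.add a b = S.add b a
  mul_assoc : ∀ a b c, S.mul (S.mul a b) c = S.mul a (S.mul b c)
  mul_comm : ∀ a b, S.mul a b = S.mul b a
  distrib : ∀ a b c, S.mul a (S.add b c) = S.add (S.mul a b) (S.mul a c)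
  add_zero : ∀ a, S.add a S.zero = a
  mul_zero : ∀ a, S.mul a S.zero = S.zero
  mul_one : ∀ a, S.mul a S.one = a
  lt_irrefl : ∀ a, ¬ S.lt a a
  lt_trans : ∀ a b c, S.lt a b → S.lt b c → S.lt a c
  lt_total : ∀ a b, S.lt a b ∨ a = b ∨ S.lt b a
  add_lt_add : ∀ a b c, S.lt a b → S.lt (S.add a c) (S.add b c)
  mul_lt_mul : ∀ a b c, S.lt a b → S.lt S.zero c → S.lt (S.mul a c) (S.mul b c)
  zero_lt_one : S.lt S.zero S.one
  zero_le : ∀ a, a = S.zero ∨ S.lt S.zero a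
  discrete : ∀ a b, S.lt a b → S.add a S.one = b ∨ S.lt (S.add a S.one) b
  pred : ∀ a, S.lt S.zero a → ∃ b, S.add b S.one = a
  sub : ∀ a b, S.lt a b → ∃ c, S.add a c = b

/-- The induction scheme for the class `Γ` of formulas
(parameters are allowed via the ambient valuation `v`). -/
def IndFor (S : Str) (Γ : Fml → Prop) : Prop :=
  ∀ φ : Fml, Γ φ → ∀ (v : ℕ → S.M) (x : ℕ),
    Sat0 S (upd v x S.zero) φ →
    (∀ m, Sat0 S (upd v x m) φ → Sat0 S (upd v x (S.add m S.one)) φ) →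
    ∀ m, Sat0 S (upd v x m) φ

/-- The collection scheme for the class `Γ`:
`(∀ x < a ∃ y φ) → (∃ b ∀ x < a ∃ y < b φ)`. -/
def CollFor (S : Str) (Γ : Fml → Prop) : Prop :=
  ∀ φ : Fml, Γ φ → ∀ (v : ℕ → S.M) (x y : ℕ), x ≠ y → ∀ a : S.M,
    (∀ m, S.lt m a → ∃ k, Sat0 S (upd (upd v x m) y k) φ) →
    ∃ b, ∀ m, S.lt m a → ∃ k, S.lt k b ∧ Sat0 S (upd (upd v x m) y k) φ

/-- `IΔ₀` (over `PA⁻`). -/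
def IDelta0 (S : Str) : Prop := PAminus S ∧ IndFor S Delta0

/-- `IΣₙ` (over `PA⁻`; note `Δ₀ ⊆ Σₙ`, so this includes `IΔ₀`). -/
def ISigma (S : Str) (n : ℕ) : Prop := PAminus S ∧ IndFor S (IsSigma n)

/-- `BΣₙ`: the `Σₙ`-collection scheme, including `IΔ₀` (over `PA⁻`). -/
def BSigma (S : Str) (n : ℕ) : Prop := IDelta0 S ∧ CollFor S (IsSigma n)

/-- The weak regularity principle `WRφ` for all `φ` in the class `Γ`:
the universal closure of `(∀ x ∃ y < a φ(x,y)) → (∃ y < a ∀ b ∃ x > b φ(x,y))`.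
Here `x, y` are the two displayed variables and all other free variables of
`φ` are parameters, interpreted by the ambient valuation `v`. -/
def WRFor (S : Str) (Γ : Fml → Prop) : Prop :=
  ∀ φ : Fml, Γ φ → ∀ (v : ℕ → S.M) (x y : ℕ), x ≠ y → ∀ a : S.M,
    (∀ m, ∃ k, S.lt k a ∧ Sat0 S (upd (upd v x m) y k) φ) →
    ∃ k, S.lt k a ∧ ∀ b, ∃ m, S.lt b m ∧ Sat0 S (upd (upd v x m) y k) φ

/-! ## Second-order theories -/

/-- Second-order induction scheme for the class `Γ`, with set parameters
from the second-order universe `X`. -/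
def IndForSO (S : Str) (X : Set (Set S.M)) (Γ : Fml → Prop) : Prop :=
  ∀ φ : Fml, Γ φ → ∀ (v : ℕ → S.M) (w : ℕ → Set S.M), (∀ i, w i ∈ X) → ∀ x : ℕ,
    Sat S X (upd v x S.zero) w φ →
    (∀ m, Sat S X (upd v x m) w φ → Sat S X (upd v x (S.add m S.one)) w φ) →
    ∀ m, Sat S X (upd v x m) w φ

/-- Second-order collection scheme for the class `Γ`. -/
def CollForSO (S : Str) (X : Set (Set S.M)) (Γ : Fml → Prop) : Prop :=
  ∀ φ : Fml, Γ φ → ∀ (v : ℕ → S.M) (w : ℕ → Set S.M), (∀ i, w i ∈ X) →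
    ∀ (x y : ℕ), x ≠ y → ∀ a : S.M,
    (∀ m, S.lt m a → ∃ k, Sat S X (upd (upd v x m) y k) w φ) →
    ∃ b, ∀ m, S.lt m a → ∃ k, S.lt k b ∧ Sat S X (upd (upd v x m) y k) w φ

/-- `Δ₁⁰`-comprehension. -/
def Delta1CA (S : Str) (X : Set (Set S.M)) : Prop :=
  ∀ φ ψ : Fml, SigmaSO 1 φ → PiSO 1 ψ →
    ∀ (v : ℕ → S.M) (w : ℕ → Set S.M), (∀ i, w i ∈ X) → ∀ x : ℕ,
    (∀ m, Sat S X (upd v x m) w φ ↔ Sat S X (upd v x m) w ψ) →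
    ∃ A ∈ X, ∀ m, m ∈ A ↔ Sat S X (upd v x m) w φ

/-- `Σₙ`-comprehension for first-order formulas with parameters from `M`. -/
def SigmaCA (S : Str) (X : Set (Set S.M)) (n : ℕ) : Prop :=
  ∀ φ : Fml, IsSigma n φ → ∀ (v : ℕ → S.M) (x : ℕ),
    ∃ A ∈ X, ∀ m, m ∈ A ↔ Sat0 S (upd v x m) φ

/-- `RCA₀`. -/
def RCA0 (S : Str) (X : Set (Set S.M)) : Prop :=
  PAminus S ∧ IndForSO S X (SigmaSO 1) ∧ Delta1CA S X

/-- `Σ₁⁰`-separation; over `RCA₀` this is equivalent to weak Kőnig's lemma. -/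
def Sigma1Sep (S : Str) (X : Set (Set S.M)) : Prop :=
  ∀ φ ψ : Fml, SigmaSO 1 φ → SigmaSO 1 ψ →
    ∀ (v : ℕ → S.M) (w : ℕ → Set S.M), (∀ i, w i ∈ X) → ∀ x : ℕ,
    (∀ m, ¬ (Sat S X (upd v x m) w φ ∧ Sat S X (upd v x m) w ψ)) →
    ∃ A ∈ X, ∀ m, (Sat S X (upd v x m) w φ → m ∈ A) ∧ (m ∈ A → ¬ Sat S X (upd v x m) w ψ)

/-- `WKL₀`, rendered as `RCA₀` plus `Σ₁⁰`-separation (which is equivalent,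
over `RCA₀`, to weak Kőnig's lemma). -/
def WKL0 (S : Str) (X : Set (Set S.M)) : Prop := RCA0 S X ∧ Sigma1Sep S X

/-- `BΣₙ⁰`: the second-order `Σₙ⁰`-collection scheme (including `IΔ₀⁰`,
over `PA⁻`). -/
def BSigmaSO (S : Str) (X : Set (Set S.M)) (n : ℕ) : Prop :=
  PAminus S ∧ IndForSO S X Delta0SO ∧ CollForSO S X (SigmaSO n)

/-- `IΣₙ⁰`: the second-order `Σₙ⁰`-induction scheme, over `RCA₀`. -/
def ISigmaSO (S : Str) (X : Set (Set S.M)) (n : ℕ) : Prop :=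
  RCA0 S X ∧ IndForSO S X (SigmaSO n)

/-! ## Exponentiation and binary digits -/

/-- Satisfaction of a three-variable formula `E(x₀, x₁, x₂)` at `(a, b, c)`. -/
def ExpAt (S : Str) (E : Fml) (a b c : S.M) : Prop :=
  Sat0 S (fun i => if i = 0 then a else if i = 1 then b else c) E

/-- `E(x₀,x₁,x₂)` is a `Δ₀` definition of the (total) exponentiation function
`x₀ ^ x₁ = x₂`.  The existence of such an `E` expresses `exp`
(the totality of exponentiation). -/
structure IsExpDef (S : Str) (E : Fml) : Prop where
  delta0 : Delta0 E
  base : ∀ a, ExpAt S E a S.zero S.one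
  total : ∀ a b, ∃ c, ExpAt S E a b c
  unique : ∀ a b c c', ExpAt S E a b c → ExpAt S E a b c' → c = c'
  step : ∀ a b c, ExpAt S E a b c → ExpAt S E a (S.add b S.one) (S.mul c a)

/-- `exp`: the totality of exponentiation (via a `Δ₀` definition of its
graph). -/
def SatExp (S : Str) : Prop := ∃ E : Fml, IsExpDef S E

/-! ## Embeddings, end extensions and elementarity -/

/-- An embedding of arithmetic structures. -/
structure Emb (S K : Str) where
  j : S.M → K.M
  inj : Function.Injective j
  zero : j S.zero = K.zero
  one : j S.one = K.one
  add : ∀ a b, j (S.add a b) = K.add (j a) (j b)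
  mul : ∀ a b, j (S.mul a b) = K.mul (j a) (j b)
  lt_iff : ∀ a b, S.lt a b ↔ K.lt (j a) (j b)

/-- The extension along `e` is an end extension: every element of `K` not in
the image of `M` exceeds every element of `M`. -/
def IsEndExt {S K : Str} (e : Emb S K) : Prop :=
  ∀ b : K.M, b ∉ Set.range e.j → ∀ a : S.M, K.lt (e.j a) b

/-- The extension along `e` is proper. -/
def IsProper {S K : Str} (e : Emb S K) : Prop := ¬ Function.Surjective e.j

/-- The extension along `e` is `Σₙ`-elementary: all `Σₙ` formulas with
parameters from `M` are absolute between `M` and `K`. -/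
def SigmaElem {S K : Str} (e : Emb S K) (n : ℕ) : Prop :=
  ∀ φ : Fml, IsSigma n φ → ∀ v : ℕ → S.M,
    (Sat0 S v φ ↔ Sat0 K (fun i => e.j (v i)) φ)

/-- `K ⊨ M‑IΣₙ` (for an extension `e : M → K`): induction up to any `a ∈ M`
for `Σₙ` formulas with parameters from `K`. -/
def MISigma {S K : Str} (e : Emb S K) (n : ℕ) : Prop :=
  ∀ φ : Fml, IsSigma n φ → ∀ (v : ℕ → K.M) (x : ℕ) (a : S.M),
    Sat0 K (upd v x K.zero) φ →
    (∀ m, K.lt m (e.j a) → (Sat0 K (upd v x m) φ → Sat0 K (upd v x (K.add m K.one)) φ)) →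
    ∀ m, K.lt m (e.j a) → Sat0 K (upd v x m) φ

/-- The `x`-th binary digit of `c ∈ K` is `1`, computed via a `Δ₀` definition
`E` of exponentiation on the ground model `S` (here `x` lies under the image
of `S`): there are `x', p ∈ M` with `j x' = x`, `p = 2 ^ x'`, and `u, v ∈ K`
with `c = u·(2p) + p + v` and `v < p`. -/
def BitVia {S K : Str} (e : Emb S K) (E : Fml) (x c : K.M) : Prop :=
  ∃ x' p : S.M, e.j x' = x ∧ ExpAt S E (S.add S.one S.one) x' p ∧
    ∃ u v : K.M, K.lt v (e.j p) ∧
      c = K.add (K.add (K.mul u (K.add (e.j p) (e.j p))) (e.j p)) v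

/-! ## The second-order restricted ultrapower -/

/-- `A` is cofinal (unbounded) in `S`. -/
def Cofinal (S : Str) (A : Set S.M) : Prop := ∀ b : S.M, ∃ x ∈ A, S.lt b x

/-- The pairing term `⟨x, y⟩ = (x + y)·(x + y) + x`. -/
def pairS (S : Str) (x y : S.M) : S.M := S.add (S.mul (S.add x y) (S.add x y)) x

/-- The graph of `f : M → M`, coded as a subset of `M` via pairing. -/
def graphOf (S : Str) (f : S.M → S.M) : Set S.M := {m | ∃ x, m = pairS S x (f x)}

/-- `f` is a total function `M → M` lying in the second-order universe `X`
(its coded graph belongs to `X`).  The collection of such `f` is the class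
`ℱ` of the restricted ultrapower. -/
def FuncIn (S : Str) (X : Set (Set S.M)) (f : S.M → S.M) : Prop := graphOf S f ∈ X

/-- `U` is an ultrafilter on the Boolean algebra `X`, all of whose elements
are cofinal in `M`. -/
structure UltraOn (S : Str) (X U : Set (Set S.M)) : Prop where
  subset : U ⊆ X
  univ_mem : Set.univ ∈ U
  empty_not_mem : ∅ ∉ U
  inter_mem : ∀ A ∈ U, ∀ B ∈ U, A ∩ B ∈ U
  superset_mem : ∀ A ∈ U, ∀ B ∈ X, A ⊆ B → B ∈ U
  ultra : ∀ A ∈ X, A ∈ U ∨ Aᶜ ∈ U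
  cofinal : ∀ A ∈ U, Cofinal S A

/-- A realization of the second-order restricted ultrapower `ℱ/𝒰` of `S`
with respect to the second-order universe `X` and the ultrafilter `U`:
a structure `K` whose elements are exactly the classes `cls f hf = [f]` of
total functions `f ∈ ℱ`, where `[f] = [g]` iff `f = g` on a set in `U`, with
pointwise arithmetic operations, order decided by `U`, and the inherited
second-order membership relation `memK` serving as the second-order expansion. -/
structure RUP (S : Str) (X U : Set (Set S.M)) : Type 1 where
  K : Str
  cls : (f : S.M → S.M) → FuncIn S X f → K.M
  memK : K.M → Set S.M → Prop
  const_in : ∀ a : S.M, FuncIn S X (fun _ => a)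
  surj : ∀ b : K.M, ∃ (f : S.M → S.M) (hf : FuncIn S X f), cls f hf = b
  eq_iff : ∀ (f : S.M → S.M) (hf : FuncIn S X f) (g : S.M → S.M) (hg : FuncIn S X g),
      (cls f hf = cls g hg) ↔ {i : S.M | f i = g i} ∈ U
  lt_iff : ∀ (f : S.M → S.M) (hf : FuncIn S X f) (g : S.M → S.M) (hg : FuncIn S X g),
      K.lt (cls f hf) (cls g hg) ↔ {i : S.M | S.lt (f i) (g i)} ∈ U
  zero_eq : K.zero = cls (fun _ => S.zero) (const_in S.zero)
  one_eq : K.one = cls (fun _ => S.one) (const_in S.one)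
  add_eq : ∀ (f : S.M → S.M) (hf : FuncIn S X f) (g : S.M → S.M) (hg : FuncIn S X g)
      (h : S.M → S.M) (hh : FuncIn S X h), (∀ i, h i = S.add (f i) (g i)) →
      K.add (cls f hf) (cls g hg) = cls h hh
  mul_eq : ∀ (f : S.M → S.M) (hf : FuncIn S X f) (g : S.M → S.M) (hg : FuncIn S X g)
      (h : S.M → S.M) (hh : FuncIn S X h), (∀ i, h i = S.mul (f i) (g i)) →
      K.mul (cls f hf) (cls g hg) = cls h hh
  mem_iff : ∀ (f : S.M → S.M) (hf : FuncIn S X f) (A : Set S.M), A ∈ X →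
      (memK (cls f hf) A ↔ {i : S.M | f i ∈ A} ∈ U)

/-- The canonical embedding `M → ℱ/𝒰` via constant functions. -/
def RUP.emb {S : Str} {X U : Set (Set S.M)} (R : RUP S X U) (a : S.M) : R.K.M :=
  R.cls (fun _ => a) (R.const_in a)

/-- The subset of `ℱ/𝒰` induced by `A ⊆ M`. -/
def RUP.setImg {S : Str} {X U : Set (Set S.M)} (R : RUP S X U) (A : Set S.M) :
    Set R.K.M := {b | R.memK b A}

/-- The second-order part of the expanded ultrapower `(ℱ/𝒰, 𝒳)`:
the (injected) copy of `X`. -/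
def RUP.X2 {S : Str} {X U : Set (Set S.M)} (R : RUP S X U) : Set (Set R.K.M) :=
  (fun A => R.setImg A) '' X

end PaperArith

namespace PaperArith

/-! ## Models of `PA⁻` as ordered semirings -/

/-- Every positive element is at least one, in a translation invariant form. -/
class DiscreteOrd (M : Type) [CommSemiring M] [LinearOrder M] : Prop where
  succ_le : ∀ a b : M, a < b → a + 1 ≤ b

/-- The structure for the language of arithmetic given by an ordered semiring. -/
abbrev str (M : Type) [CommSemiring M] [LinearOrder M] : Str :=
  ⟨M, 0, 1, (· + ·), (· * ·), (· < ·)⟩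

theorem exists_eq_str {S : Str} (h : PAminus S) :
    ∃ (M : Type) (_ : CommSemiring M) (_ : LinearOrder M) (_ : IsStrictOrderedRing M)
      (_ : CanonicallyOrderedAdd M) (_ : DiscreteOrd M), S = str M := by
  classical
  have zadd : ∀ a, S.add S.zero a = a := fun a => by rw [h.add_comm, h.add_zero]
  let : Zero S.M := ⟨S.zero⟩
  let : One S.M := ⟨S.one⟩
  let : Add S.M := ⟨S.add⟩
  let : Mul S.M := ⟨S.mul⟩
  let i1 : CommSemiring S.M :=
    { add := S.add, zero := S.zero, mul := S.mul, one := S.one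
      add_assoc := h.add_assoc
      zero_add := zadd
      add_zero := h.add_zero
      add_comm := h.add_comm
      nsmul := nsmulRec
      left_distrib := h.distrib
      right_distrib := fun a b c => by
        change S.mul (S.add a b) c = S.add (S.mul a c) (S.mul b c)
        rw [h.mul_comm, h.distrib, h.mul_comm c a, h.mul_comm c b]
      zero_mul := fun a => by
        change S.mul S.zero a = S.zero
        rw [h.mul_comm, h.mul_zero]
      mul_zero := h.mul_zero
      mul_assoc := h.mul_assoc
      one_mul := fun a => by
        change S.mul S.one a = a
        rw [h.mul_comm, h.mul_one]
      mul_one := h.mul_one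
      mul_comm := h.mul_comm
      npow := npowRec }
  let i2 : LinearOrder S.M :=
    { lt := S.lt
      le := fun a b => S.lt a b ∨ a = b
      le_refl := fun a => Or.inr rfl
      le_trans := by
        rintro a b c (hab | rfl) (hbc | rfl)
        · exact Or.inl (h.lt_trans _ _ _ hab hbc)
        · exact Or.inl hab
        · exact Or.inl hbc
        · exact Or.inr rfl
      lt_iff_le_not_ge := by
        intro a b
        constructor
        · intro hab
          refine ⟨Or.inl hab, ?_⟩
          rintro (hba | rfl)
          · exact h.lt_irrefl _ (h.lt_trans _ _ _ hab hba)
          · exact h.lt_irrefl _ hab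
        · rintro ⟨hab | rfl, hn⟩
          · exact hab
          · exact absurd (Or.inr rfl) hn
      le_antisymm := by
        rintro a b (hab | rfl) (hba | hba)
        · exact absurd (h.lt_trans _ _ _ hab hba) (h.lt_irrefl _)
        · exact hba.symm
        · rfl
        · rfl
      le_total := by
        intro a b
        rcases h.lt_total a b with hab | hab | hab
        · exact Or.inl (Or.inl hab)
        · exact Or.inl (Or.inr hab)
        · exact Or.inr (Or.inl hab)
      toDecidableLE := Classical.decRel _ }
  have hlt : ∀ a b : S.M, a < b → ∀ c, a + c < b + c := fun a b hab c => h.add_lt_add a b c hab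
  have hmul : ∀ c : S.M, 0 < c → ∀ a b : S.M, a < b → a * c < b * c :=
    fun c hc a b hab => h.mul_lt_mul a b c hab hc
  have hzero : ∀ a : S.M, 0 ≤ a := fun a => (h.zero_le a).elim (fun e => Or.inr e.symm) Or.inl
  have hadd : ∀ a b : S.M, a ≤ b → ∀ c, a + c ≤ b + c := by
    rintro a b (hab | rfl) c
    · exact Or.inl (hlt _ _ hab c)
    · exact Or.inr rfl
  have hadd' : ∀ a b : S.M, a ≤ b → ∀ c, c + a ≤ c + b := by
    intro a b hab c
    rw [add_comm c, add_comm c]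
    exact hadd a b hab c
  refine ⟨S.M, i1, i2, ?_, ?_, ?_, rfl⟩
  · exact
      { add_le_add_left := hadd
        le_of_add_le_add_left := by
          intro a b c hle
          by_contra hn
          have := hlt _ _ (not_le.1 hn) a
          rw [add_comm c, add_comm b] at this
          exact absurd hle (not_le.2 this)
        zero_le_one := Or.inl h.zero_lt_one
        exists_pair_ne := ⟨S.zero, S.one, fun e => h.lt_irrefl S.zero (by
          have := h.zero_lt_one
          rwa [← e] at this)⟩
        mul_lt_mul_of_pos_left := by
          intro a ha b c hbc
          change a * b < a * c
          rw [mul_comm a b, mul_comm a c]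
          exact hmul a ha _ _ hbc
        mul_lt_mul_of_pos_right := fun a ha b c hbc => hmul a ha _ _ hbc }
  · exact
      { exists_add_of_le := by
          rintro a b (hab | rfl)
          · obtain ⟨c, hc⟩ := h.sub a b hab
            exact ⟨c, hc.symm⟩
          · exact ⟨0, (add_zero a).symm⟩
        le_add_self := fun a b => by
          simpa using hadd 0 b (hzero b) a
        le_self_add := fun a b => by
          simpa using hadd' 0 b (hzero b) a }
  · exact ⟨fun a b hab => (h.discrete a b hab).elim (fun e => Or.inr e) Or.inl⟩

set_option linter.unusedSectionVars false

section Model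

variable {M : Type} [CommSemiring M] [LinearOrder M] [IsStrictOrderedRing M]
  [CanonicallyOrderedAdd M] [DiscreteOrd M]

theorem lt_add_one_iff_le {a b : M} : a < b + 1 ↔ a ≤ b := by
  constructor
  · intro h
    have := DiscreteOrd.succ_le _ _ h
    exact le_of_add_le_add_right this
  · intro h
    exact lt_of_le_of_lt h (lt_add_one b)

theorem eq_zero_or_succ (a : M) : a = 0 ∨ ∃ b, a = b + 1 := by
  rcases eq_or_ne a 0 with h | h
  · exact Or.inl h
  · have h1 : (0 : M) + 1 ≤ a := DiscreteOrd.succ_le _ _ (pos_iff_ne_zero.2 h)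
    obtain ⟨c, hc⟩ := exists_add_of_le h1
    exact Or.inr ⟨c, by rw [hc]; ring⟩

theorem paminus_str : PAminus (str M) where
  add_assoc := add_assoc
  add_comm := add_comm
  mul_assoc := mul_assoc
  mul_comm := mul_comm
  distrib := mul_add
  add_zero := add_zero
  mul_zero := mul_zero
  mul_one := mul_one
  lt_irrefl := lt_irrefl
  lt_trans := fun _ _ _ => lt_trans
  lt_total := lt_trichotomy
  add_lt_add := fun a b c h => add_lt_add_left h c
  mul_lt_mul := fun a b c h hc => mul_lt_mul_of_pos_right h hc
  zero_lt_one := zero_lt_one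
  zero_le := fun a => by
    rcases eq_or_ne a 0 with h | h
    · exact Or.inl h
    · exact Or.inr (pos_iff_ne_zero.2 h)
  discrete := fun a b h => (DiscreteOrd.succ_le a b h).eq_or_lt
  pred := fun a h => by
    rcases eq_zero_or_succ a with rfl | ⟨b, rfl⟩
    · exact absurd h (lt_irrefl _)
    · exact ⟨b, rfl⟩
  sub := fun a b h => by
    obtain ⟨c, hc⟩ := exists_add_of_le h.le
    exact ⟨c, hc.symm⟩

/-- The pairing function. -/
def pr (x y : M) : M := (x + y) * (x + y) + x

theorem not_add_lt_of_pr_eq {x y x' y' : M} (h : pr x y = pr x' y') : ¬ x + y < x' + y' := by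
  intro hlt
  obtain ⟨c, hc⟩ := exists_add_of_le (DiscreteOrd.succ_le _ _ hlt)
  unfold pr at h
  rw [hc] at h
  have h2 : (x + y) * (x + y) + x
      = (x + y) * (x + y) + (x + (x + 2 * y + (x + y) * c * 2 + (1 + c) * (1 + c) + x')) := by
    rw [h]; ring
  have h3 := add_left_cancel h2
  have h4 : x + 0 = x + (x + 2 * y + (x + y) * c * 2 + (1 + c) * (1 + c) + x') := by
    rw [add_zero]; exact h3
  have h5 := add_left_cancel h4
  have h6 : (0 : M) < x + 2 * y + (x + y) * c * 2 + (1 + c) * (1 + c) + x' := by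
    have : (0 : M) < (1 + c) * (1 + c) := by positivity
    positivity
  exact absurd h5 h6.ne

theorem pr_inj {x y x' y' : M} : pr x y = pr x' y' ↔ x = x' ∧ y = y' := by
  constructor
  · intro h
    have h1 : x + y = x' + y' :=
      le_antisymm (not_lt.1 (not_add_lt_of_pr_eq h.symm)) (not_lt.1 (not_add_lt_of_pr_eq h))
    have h2 : x = x' := by
      unfold pr at h
      rw [h1] at h
      exact add_left_cancel h
    subst h2
    exact ⟨rfl, add_left_cancel h1⟩
  · rintro ⟨rfl, rfl⟩
    rfl

theorem le_mul_self_of_discrete (a : M) : a ≤ a * a := by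
  rcases eq_zero_or_succ a with rfl | ⟨b, rfl⟩
  · simp
  · exact le_mul_of_one_le_left (by positivity) le_add_self

theorem left_le_pr (x y : M) : x ≤ pr x y := le_add_self

theorem right_le_pr (x y : M) : y ≤ pr x y :=
  calc y ≤ x + y := le_add_self
    _ ≤ (x + y) * (x + y) := le_mul_self_of_discrete _
    _ ≤ pr x y := le_self_add

open Classical in
/-- The first component of a pair (zero if the argument is not a pair). -/
noncomputable def fst (n : M) : M := if h : ∃ x y, n = pr x y then h.choose else 0

open Classical in
/-- The second component of a pair (zero if the argument is not a pair). -/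
noncomputable def snd (n : M) : M := if h : ∃ x y, n = pr x y then h.choose_spec.choose else 0

theorem fst_snd_pr (x y : M) : fst (pr x y) = x ∧ snd (pr x y) = y := by
  have h : ∃ x' y', pr x y = pr x' y' := ⟨x, y, rfl⟩
  have hs := pr_inj.1 h.choose_spec.choose_spec
  unfold fst snd
  rw [dif_pos h, dif_pos h]
  exact ⟨hs.1.symm, hs.2.symm⟩

@[simp] theorem fst_pr (x y : M) : fst (pr x y) = x := (fst_snd_pr x y).1

@[simp] theorem snd_pr (x y : M) : snd (pr x y) = y := (fst_snd_pr x y).2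

theorem fst_of_not {n : M} (h : ¬ ∃ x y, n = pr x y) : fst n = 0 := by
  unfold fst
  rw [dif_neg h]

theorem snd_of_not {n : M} (h : ¬ ∃ x y, n = pr x y) : snd n = 0 := by
  unfold snd
  rw [dif_neg h]

end Model

/-! ## Sets and functions in the second-order universe -/

section Coding

variable {M : Type} [CommSemiring M] [LinearOrder M] [IsStrictOrderedRing M]
  [CanonicallyOrderedAdd M] [DiscreteOrd M] {X : Set (Set M)}

/-- The predicate `P` belongs to the second-order universe. -/
def Cd (X : Set (Set M)) (P : M → Prop) : Prop := {n | P n} ∈ X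

/-- The function `f` has its graph in the second-order universe. -/
def Fn (X : Set (Set M)) (f : M → M) : Prop := Cd X fun n => ∃ x, n = pr x (f x)

/-- The term denoting the pair of two terms. -/
def prT (t u : Term) : Term := .add (.mul (.add t u) (.add t u)) t

@[simp] theorem tval_prT (v : ℕ → M) (t u : Term) :
    tval (str M) v (prT t u) = (pr (tval (str M) v t : M) (tval (str M) v u) : M) := rfl

/-- The valuation of set variables with the given first two values. -/
def two {α : Type} (A B : α) : ℕ → α := fun i => if i = 0 then A else B

theorem two_mem {α : Type} {X : Set α} {A B : α} (hA : A ∈ X) (hB : B ∈ X) (i : ℕ) :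
    two A B i ∈ X := by
  unfold two; split_ifs <;> assumption

theorem cd_of_delta0 (hR : RCA0 (str M) X) {P : M → Prop} (φ : Fml) (hφ : Delta0SO φ)
    (v : ℕ → M) (w : ℕ → Set M) (hw : ∀ i, w i ∈ X)
    (h : ∀ m, Sat (str M) X (upd v 0 m) w φ ↔ P m) : Cd X P := by
  obtain ⟨A, hA, hA2⟩ := hR.2.2 φ φ (.delta0 hφ) (.delta0 hφ) v w hw 0 (fun m => Iff.rfl)
  have : {n | P n} = A := by
    ext m; exact ((hA2 m).trans (h m)).symm
  unfold Cd
  rw [this]; exact hA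

theorem Cd.not (hR : RCA0 (str M) X) {P : M → Prop} (hP : Cd X P) : Cd X fun n => ¬ P n :=
  cd_of_delta0 hR (.not (.mem (.var 0) 0)) (by repeat constructor) (fun _ => 0)
    (fun _ => {n | P n}) (fun _ => hP) (fun m => by simp [Sat, tval, upd])

theorem Cd.and (hR : RCA0 (str M) X) {P Q : M → Prop} (hP : Cd X P) (hQ : Cd X Q) :
    Cd X fun n => P n ∧ Q n :=
  cd_of_delta0 hR (.and (.mem (.var 0) 0) (.mem (.var 0) 1)) (by repeat constructor) (fun _ => 0)
    (two {n | P n} {n | Q n}) (two_mem hP hQ) (fun m => by simp [Sat, tval, upd, two])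

theorem Cd.or (hR : RCA0 (str M) X) {P Q : M → Prop} (hP : Cd X P) (hQ : Cd X Q) :
    Cd X fun n => P n ∨ Q n := by
  have := ((hP.not hR).and hR (hQ.not hR)).not hR
  simp only [not_and_or, not_not] at this
  exact this

theorem Cd.imp (hR : RCA0 (str M) X) {P Q : M → Prop} (hP : Cd X P) (hQ : Cd X Q) :
    Cd X fun n => P n → Q n := by
  simpa [imp_iff_not_or] using (hP.not hR).or hR hQ

/-- Recognizing membership of `pr x y` in the graph of `f`. -/
theorem pr_mem_graph {f : M → M} {x y : M} : (∃ x', pr x y = pr x' (f x')) ↔ y = f x := by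
  constructor
  · rintro ⟨x', h⟩
    obtain ⟨rfl, h⟩ := pr_inj.1 h
    exact h
  · rintro rfl
    exact ⟨x, rfl⟩

theorem Cd.comp (hR : RCA0 (str M) X) {P : M → Prop} {f : M → M} (hP : Cd X P) (hf : Fn X f) :
    Cd X fun n => P (f n) := by
  obtain ⟨A, hA, hA2⟩ := hR.2.2
    (.ex 1 (.and (.mem (prT (.var 0) (.var 1)) 0) (.mem (.var 1) 1)))
    (.all 1 (.imp (.mem (prT (.var 0) (.var 1)) 0) (.mem (.var 1) 1)))
    (.ex _ (.delta0 (by repeat constructor))) (.all _ (.delta0 (by repeat constructor)))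
    (fun _ => 0) (two {n | ∃ x, n = pr x (f x)} {n | P n}) (two_mem hf hP) 0
    (fun m => by simp [Sat, tval, upd, two, pr_mem_graph])
  have : {n | P (f n)} = A := by
    ext m; rw [hA2]; simp [Sat, tval, upd, two, pr_mem_graph]
  unfold Cd
  rw [this]; exact hA

/-- A total function with a `Σ₁` graph belongs to the second-order universe. In the defining
formula `δ`, variable `0` is the argument, `1` the value, `2` a witness and `5` a parameter. -/
theorem fn_of_sigma1 (hR : RCA0 (str M) X) {f : M → M} (δ : Fml) (hδ : Delta0SO δ)
    (w : ℕ → Set M) (hw : ∀ i, w i ∈ X) (p : M) (E : M → M → M → Prop)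
    (hE : ∀ v : ℕ → M, v 5 = p → (Sat (str M) X v w δ ↔ E (v 0) (v 1) (v 2)))
    (hf : ∀ x y, y = f x ↔ ∃ z, E x y z) : Fn X f := by
  have hpair : ∀ m : M, (∃ x, x < m + 1 ∧ ∃ y, y < m + 1 ∧ m = pr x y) ↔ ∃ x y, m = pr x y := by
    intro m
    constructor
    · rintro ⟨x, -, y, -, h⟩; exact ⟨x, y, h⟩
    · rintro ⟨x, y, rfl⟩
      exact ⟨x, lt_add_one_iff_le.2 (left_le_pr _ _), y, lt_add_one_iff_le.2 (right_le_pr _ _), rfl⟩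
  have key1 : ∀ m : M, Sat (str M) X (upd (fun _ => p) 4 m) w
      (.ex 2 (.bex 0 (.add (.var 4) .one) (.bex 1 (.add (.var 4) .one)
        (.and (.eq (.var 4) (prT (.var 0) (.var 1))) δ)))) ↔ ∃ x, m = pr x (f x) := by
    intro m
    simp only [Sat, tval, tval_prT]
    have : ∀ z x y : M, Sat (str M) X (upd (upd (upd (upd (fun _ => p) 4 m) 2 z) 0 x) 1 y) w δ ↔
        E x y z := by
      intro z x y
      rw [hE _ (by simp [upd])]
      simp [upd]
    simp only [this]
    simp only [upd]
    constructor
    · rintro ⟨z, x, -, y, -, h1, h2⟩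
      refine ⟨x, ?_⟩
      rw [← (hf x y).2 ⟨z, h2⟩]
      simpa using h1
    · rintro ⟨x, rfl⟩
      obtain ⟨z, hz⟩ := (hf x (f x)).1 rfl
      refine ⟨z, x, ?_, f x, ?_, ?_, hz⟩
      · simpa using lt_add_one_iff_le.2 (left_le_pr x (f x))
      · simpa using lt_add_one_iff_le.2 (right_le_pr x (f x))
      · simp
  have key2 : ∀ m : M, Sat (str M) X (upd (fun _ => p) 4 m) w
      (.all 2 (.all 1 (.and
        (.bex 0 (.add (.var 4) .one) (.bex 3 (.add (.var 4) .one)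
          (.eq (.var 4) (prT (.var 0) (.var 3)))))
        (.ball 0 (.add (.var 4) .one) (.ball 3 (.add (.var 4) .one)
          (.imp (.eq (.var 4) (prT (.var 0) (.var 3))) (.imp δ (.eq (.var 1) (.var 3)))))))))
      ↔ ∃ x, m = pr x (f x) := by
    intro m
    simp only [Sat, tval, tval_prT]
    have : ∀ z y' x y : M,
        Sat (str M) X (upd (upd (upd (upd (upd (fun _ => p) 4 m) 2 z) 1 y') 0 x) 3 y) w δ ↔
        E x y' z := by
      intro z y' x y
      rw [hE _ (by simp [upd])]
      simp [upd]
    simp only [this]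
    simp only [upd]
    simp only [reduceIte, Nat.reduceEqDiff, OfNat.zero_ne_ofNat,
      OfNat.one_ne_ofNat, zero_ne_one, one_ne_zero, OfNat.ofNat_ne_zero, OfNat.ofNat_ne_one]
    constructor
    · intro h
      obtain ⟨x, -, y, -, rfl⟩ := (h 0 0).1
      obtain ⟨z, hz⟩ := (hf x (f x)).1 rfl
      have := (h z (f x)).2 x (lt_add_one_iff_le.2 (left_le_pr _ _)) y
        (lt_add_one_iff_le.2 (right_le_pr _ _)) rfl hz
      exact ⟨x, by rw [← this]⟩
    · rintro ⟨x, rfl⟩ z y'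
      refine ⟨(hpair _).2 ⟨x, f x, rfl⟩, ?_⟩
      intro x' _ y _ h hE'
      obtain ⟨rfl, rfl⟩ := pr_inj.1 h
      exact (hf x y').2 ⟨z, hE'⟩
  obtain ⟨A, hA, hA2⟩ := hR.2.2 _ _
    (.ex _ (.delta0 (by repeat first | exact hδ | constructor)))
    (.all _ (.all _ (.delta0 (by repeat first | exact hδ | constructor))))
    (fun _ => p) w hw 4 (fun m => (key1 m).trans (key2 m).symm)
  have : {n | ∃ x, n = pr x (f x)} = A := by
    ext m; rw [hA2]; exact (key1 m).symm
  unfold Fn Cd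
  rw [this]; exact hA

theorem Fn.comp (hR : RCA0 (str M) X) {f g : M → M} (hg : Fn X g) (hf : Fn X f) :
    Fn X fun n => g (f n) := by
  refine fn_of_sigma1 hR (.and (.mem (prT (.var 0) (.var 2)) 0) (.mem (prT (.var 2) (.var 1)) 1))
    (by repeat constructor) (two {n | ∃ x, n = pr x (f x)} {n | ∃ x, n = pr x (g x)})
    (two_mem hf hg) 0 (fun x y z => z = f x ∧ y = g z) ?_ ?_
  · intro v _
    simp [Sat, tval, two, pr_mem_graph]
  · intro x y; simp

theorem Fn.pr (hR : RCA0 (str M) X) {f g : M → M} (hf : Fn X f) (hg : Fn X g) :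
    Fn X fun n => PaperArith.pr (f n) (g n) := by
  refine fn_of_sigma1 hR (.bex 3 (.add (.var 1) .one) (.bex 4 (.add (.var 1) .one)
    (.and (.mem (prT (.var 0) (.var 3)) 0) (.and (.mem (prT (.var 0) (.var 4)) 1)
      (.eq (.var 1) (prT (.var 3) (.var 4)))))))
    (by repeat constructor) (two {n | ∃ x, n = PaperArith.pr x (f x)}
      {n | ∃ x, n = PaperArith.pr x (g x)})
    (two_mem hf hg) 0 (fun x y z => y = PaperArith.pr (f x) (g x)) ?_ ?_
  · intro v _
    simp only [Sat, tval, two, tval_prT, upd, Set.mem_ofPred_eq, pr_mem_graph, reduceIte,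
      Nat.reduceEqDiff, OfNat.zero_ne_ofNat, OfNat.one_ne_ofNat]
    constructor
    · rintro ⟨a, -, b, -, rfl, rfl, h⟩; exact h
    · intro h
      refine ⟨f (v 0), ?_, g (v 0), ?_, rfl, rfl, h⟩
      · rw [h]; exact lt_add_one_iff_le.2 (left_le_pr _ _)
      · rw [h]; exact lt_add_one_iff_le.2 (right_le_pr _ _)
  · intro x y; simp

theorem fn_const (hR : RCA0 (str M) X) (hne : X.Nonempty) (a : M) : Fn X fun _ => a := by
  obtain ⟨A, hA⟩ := hne
  refine fn_of_sigma1 hR (.eq (.var 1) (.var 5)) (by repeat constructor) (fun _ => A)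
    (fun _ => hA) a (fun x y z => y = a) ?_ ?_
  · intro v h
    simp [Sat, tval, h]
  · intro x y; simp

theorem fn_id (hR : RCA0 (str M) X) (hne : X.Nonempty) : Fn X fun n => n := by
  obtain ⟨A, hA⟩ := hne
  refine fn_of_sigma1 hR (.eq (.var 1) (.var 0)) (by repeat constructor) (fun _ => A)
    (fun _ => hA) 0 (fun x y z => y = x) ?_ ?_
  · intro v h
    simp [Sat, tval]
  · intro x y; simp

/-- A function obtained from a term in the components of a pair. -/
theorem fn_of_term (hR : RCA0 (str M) X) (hne : X.Nonempty) (F : M → M → M) (h0 : F 0 0 = 0)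
    (t : Term)
    (ht : ∀ v : ℕ → M, tval (str M) v t = F (v 3) (v 4)) : Fn X fun n => F (fst n) (snd n) := by
  obtain ⟨A, hA⟩ := hne
  refine fn_of_sigma1 hR (.or (.bex 3 (.add (.var 0) .one) (.bex 4 (.add (.var 0) .one)
      (.and (.eq (.var 0) (prT (.var 3) (.var 4))) (.eq (.var 1) t))))
    (.and (.not (.bex 3 (.add (.var 0) .one) (.bex 4 (.add (.var 0) .one)
      (.eq (.var 0) (prT (.var 3) (.var 4)))))) (.eq (.var 1) .zero)))
    (by repeat constructor) (fun _ => A) (fun _ => hA) 0 (fun x y z => y = F (fst x) (snd x)) ?_ ?_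
  · intro v _
    simp only [Sat, tval, tval_prT, ht, upd, reduceIte,
      Nat.reduceEqDiff, OfNat.zero_ne_ofNat, OfNat.one_ne_ofNat]
    constructor
    · rintro (⟨a, -, b, -, h1, h⟩ | ⟨h1, h⟩)
      · rw [h1, fst_pr, snd_pr]; exact h
      · have : ¬ ∃ x y, v 0 = pr x y := by
          rintro ⟨x, y, h2⟩
          refine h1 ⟨x, ?_, y, ?_, h2⟩
          · rw [h2]; exact lt_add_one_iff_le.2 (left_le_pr _ _)
          · rw [h2]; exact lt_add_one_iff_le.2 (right_le_pr _ _)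
        rw [fst_of_not this, snd_of_not this, h0]; exact h
    · intro h
      by_cases h1 : ∃ x y, v 0 = pr x y
      · left
        obtain ⟨x, y, h2⟩ := h1
        refine ⟨x, ?_, y, ?_, h2, ?_⟩
        · rw [h2]; exact lt_add_one_iff_le.2 (left_le_pr _ _)
        · rw [h2]; exact lt_add_one_iff_le.2 (right_le_pr _ _)
        · rw [h2, fst_pr, snd_pr] at h; exact h
      · right
        refine ⟨?_, ?_⟩
        · rintro ⟨x, -, y, -, h2⟩
          exact h1 ⟨x, y, h2⟩
        · rw [fst_of_not h1, snd_of_not h1, h0] at h; exact h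
  · intro x y; simp

theorem Fn.fst (hR : RCA0 (str M) X) (hne : X.Nonempty) {f : M → M} (hf : Fn X f) :
    Fn X fun n => PaperArith.fst (f n) :=
  (fn_of_term hR hne (fun a _ => a) rfl (.var 3) (fun _ => rfl)).comp hR hf

theorem Fn.snd (hR : RCA0 (str M) X) (hne : X.Nonempty) {f : M → M} (hf : Fn X f) :
    Fn X fun n => PaperArith.snd (f n) :=
  (fn_of_term hR hne (fun _ b => b) rfl (.var 4) (fun _ => rfl)).comp hR hf

theorem Fn.add (hR : RCA0 (str M) X) (hne : X.Nonempty) {f g : M → M} (hf : Fn X f)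
    (hg : Fn X g) : Fn X fun n => f n + g n := by
  simpa using (fn_of_term hR hne (fun a b => a + b) (add_zero 0) (.add (.var 3) (.var 4))
    (fun _ => rfl)).comp hR (hf.pr hR hg)

theorem Fn.mul (hR : RCA0 (str M) X) (hne : X.Nonempty) {f g : M → M} (hf : Fn X f)
    (hg : Fn X g) : Fn X fun n => f n * g n := by
  simpa using (fn_of_term hR hne (fun a b => a * b) (mul_zero 0) (.mul (.var 3) (.var 4))
    (fun _ => rfl)).comp hR (hf.pr hR hg)

theorem Cd.eq (hR : RCA0 (str M) X) (hne : X.Nonempty) {f g : M → M} (hf : Fn X f)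
    (hg : Fn X g) : Cd X fun n => f n = g n := by
  have h := Cd.comp hR (fn_id hR hne) (hg.pr hR hf)
  simp only [pr_mem_graph (f := fun n : M => n)] at h
  exact h

theorem Cd.lt (hR : RCA0 (str M) X) (hne : X.Nonempty) {f g : M → M} (hf : Fn X f)
    (hg : Fn X g) : Cd X fun n => f n < g n := by
  have h : Cd X fun n : M => ∃ x y, n = PaperArith.pr x y ∧ x < y := by
    obtain ⟨A, hA⟩ := hne
    refine cd_of_delta0 hR (.bex 1 (.add (.var 0) .one) (.bex 2 (.add (.var 0) .one)
      (.and (.eq (.var 0) (prT (.var 1) (.var 2))) (.lt (.var 1) (.var 2)))))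
      (by repeat constructor) (fun _ => 0) (fun _ => A) (fun _ => hA) (fun m => ?_)
    simp only [Sat, tval, tval_prT, upd]
    constructor
    · rintro ⟨x, -, y, -, h⟩
      exact ⟨x, y, h⟩
    · rintro ⟨x, y, rfl, h⟩
      exact ⟨x, lt_add_one_iff_le.2 (left_le_pr _ _), y,
        lt_add_one_iff_le.2 (right_le_pr _ _), rfl, h⟩
  have h2 := h.comp hR (hf.pr hR hg)
  have : ∀ n, (∃ x y, PaperArith.pr (f n) (g n) = PaperArith.pr x y ∧ x < y) ↔ f n < g n := by
    intro n
    constructor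
    · rintro ⟨x, y, h, hlt⟩
      obtain ⟨rfl, rfl⟩ := pr_inj.1 h
      exact hlt
    · intro h
      exact ⟨_, _, rfl, h⟩
  simp only [this] at h2
  exact h2

theorem Cd.ball (hR : RCA0 (str M) X) (hne : X.Nonempty) {R : M → M → Prop}
    (h : Cd X fun n => R (PaperArith.fst n) (PaperArith.snd n)) {f : M → M} (hf : Fn X f) :
    Cd X fun i => ∀ m < f i, R i m := by
  have h1 : Cd X fun n : M => ∃ x y, n = PaperArith.pr x y ∧ ∀ m < y, R x m := by
    refine cd_of_delta0 hR (.bex 1 (.add (.var 0) .one) (.bex 2 (.add (.var 0) .one)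
      (.and (.eq (.var 0) (prT (.var 1) (.var 2)))
        (.ball 3 (.var 2) (.mem (prT (.var 1) (.var 3)) 0)))))
      (by repeat constructor) (fun _ => 0) (fun _ => {n | R (PaperArith.fst n) (PaperArith.snd n)})
      (fun _ => h) (fun m => ?_)
    simp only [Sat, tval, tval_prT, upd, Set.mem_ofPred_eq, fst_pr, snd_pr]
    constructor
    · rintro ⟨x, -, y, -, h⟩
      exact ⟨x, y, h⟩
    · rintro ⟨x, y, rfl, h⟩
      exact ⟨x, lt_add_one_iff_le.2 (left_le_pr _ _), y,
        lt_add_one_iff_le.2 (right_le_pr _ _), rfl, h⟩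
  have h2 := h1.comp hR ((fn_id hR hne).pr hR hf)
  have : ∀ n, (∃ x y, PaperArith.pr n (f n) = PaperArith.pr x y ∧ ∀ m < y, R x m) ↔
      ∀ m < f n, R n m := by
    intro n
    constructor
    · rintro ⟨x, y, h, hlt⟩
      obtain ⟨rfl, rfl⟩ := pr_inj.1 h
      exact hlt
    · intro h
      exact ⟨_, _, rfl, h⟩
  simp only [this] at h2
  exact h2

theorem Cd.bex (hR : RCA0 (str M) X) (hne : X.Nonempty) {R : M → M → Prop}
    (h : Cd X fun n => R (PaperArith.fst n) (PaperArith.snd n)) {f : M → M} (hf : Fn X f) :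
    Cd X fun i => ∃ m < f i, R i m := by
  have h1 := (Cd.ball (R := fun i m => ¬ R i m) hR hne (h.not hR) hf).not hR
  simpa using h1

theorem Cd.exists_least (hR : RCA0 (str M) X) {P : M → Prop} (hP : Cd X P) (hex : ∃ n, P n) :
    ∃ n, P n ∧ ∀ m < n, ¬ P m := by
  by_contra hcon
  push Not at hcon
  have hind := hR.2.1 (.ball 1 (.add (.var 0) .one) (.not (.mem (.var 1) 0)))
    (.delta0 (by repeat constructor)) (fun _ => (0 : M)) (fun _ => {n | P n}) (fun _ => hP) 0
  simp only [Sat, tval, upd, Set.mem_ofPred_eq, reduceIte] at hind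
  obtain ⟨n, hn⟩ := hex
  refine hind ?_ ?_ n n (lt_add_one n) hn
  · intro m hm hPm
    obtain ⟨k, hk, -⟩ := hcon m hPm
    have : m ≤ 0 := lt_add_one_iff_le.1 hm
    exact absurd (lt_of_lt_of_le hk this) (not_lt.2 (zero_le))
  · intro m ih k hk hPk
    obtain ⟨l, hl, hPl⟩ := hcon k hPk
    exact ih l (lt_of_lt_of_le hl (lt_add_one_iff_le.1 hk)) hPl

theorem Cd.exists_mu (hR : RCA0 (str M) X) {R : M → M → Prop}
    (h : Cd X fun n => R (PaperArith.fst n) (PaperArith.snd n))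
    (hC : ∀ i, Cd X fun m => R i m) (hex : ∀ i, ∃ m, R i m) :
    ∃ f, Fn X f ∧ ∀ i, R i (f i) ∧ ∀ m < f i, ¬ R i m := by
  choose f hf using fun i => (hC i).exists_least hR (hex i)
  refine ⟨f, ?_, hf⟩
  refine fn_of_sigma1 hR (.and (.mem (prT (.var 0) (.var 1)) 0)
    (.ball 3 (.var 1) (.not (.mem (prT (.var 0) (.var 3)) 0)))) (by repeat constructor)
    (fun _ => {n | R (PaperArith.fst n) (PaperArith.snd n)}) (fun _ => h) 0
    (fun x y _ => R x y ∧ ∀ m < y, ¬ R x m) ?_ ?_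
  · intro v _
    simp [Sat, tval, upd]
  · intro x y
    simp only [exists_const]
    constructor
    · rintro rfl
      exact hf x
    · rintro ⟨h1, h2⟩
      rcases lt_trichotomy y (f x) with h3 | h3 | h3
      · exact absurd h1 ((hf x).2 y h3)
      · exact h3
      · exact absurd (hf x).1 (h2 _ h3)

theorem Cd.mu (hR : RCA0 (str M) X) (hne : X.Nonempty) {R : M → M → Prop}
    (h : Cd X fun n => R (PaperArith.fst n) (PaperArith.snd n)) (hex : ∀ i, ∃ m, R i m) :
    ∃ f, Fn X f ∧ ∀ i, R i (f i) ∧ ∀ m < f i, ¬ R i m := by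
  refine h.exists_mu hR (fun i => ?_) hex
  have := h.comp hR ((fn_const hR hne i).pr hR (fn_id hR hne))
  simpa using this

end Coding

/-! ## Refining cofinal sets -/

section Density

variable {M : Type} [CommSemiring M] [LinearOrder M] [IsStrictOrderedRing M]
  [CanonicallyOrderedAdd M] [DiscreteOrd M] {X : Set (Set M)}

theorem exists_bound (hB : BSigmaSO (str M) X 2) {R : M → M → Prop}
    (h : Cd X fun n => R (fst n) (snd n)) (a : M) (hR : ∀ x < a, ∃ s, R x s) :
    ∃ b, ∀ x < a, ∃ s < b, R x s := by
  have := hB.2.2 (.mem (prT (.var 0) (.var 1)) 0) (.delta0 (by repeat constructor))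
    (fun _ => (0 : M)) (fun _ => {n | R (fst n) (snd n)}) (fun _ => h) 0 1 zero_ne_one a
  simp only [Sat, tval, tval_prT, upd, Set.mem_ofPred_eq, fst_pr, snd_pr, reduceIte,
    zero_ne_one] at this
  exact this hR

theorem exists_cofinal_fiber (hR : RCA0 (str M) X) (hne : X.Nonempty)
    (hB : BSigmaSO (str M) X 2) {P : M → Prop} (hP : Cd X P)
    (hcof : Cofinal (str M) {n | P n}) {f : M → M} (hf : Fn X f) (a : M)
    (ha : ∀ n, P n → f n < a) :
    ∃ c, Cofinal (str M) {n | P n ∧ f n = c} := by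
  by_contra hcon
  simp only [Cofinal, not_exists, not_forall, not_and] at hcon
  have hQ : Cd X fun n => P (snd n) ∧ f (snd n) = fst n :=
    (hP.comp hR ((fn_id hR hne).snd hR hne)).and hR
      (Cd.eq hR hne (hf.comp hR ((fn_id hR hne).snd hR hne)) ((fn_id hR hne).fst hR hne))
  have := hB.2.2 (.all 2 (.imp (.lt (.var 1) (.var 2)) (.not (.mem (prT (.var 0) (.var 2)) 0))))
    (.ofPi (.all _ (.delta0 (by repeat constructor))))
    (fun _ => (0 : M)) (fun _ => {n | P (snd n) ∧ f (snd n) = fst n}) (fun _ => hQ)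
    0 1 zero_ne_one a
  simp only [Sat, tval, tval_prT, upd, Set.mem_ofPred_eq, fst_pr, snd_pr, reduceIte,
    zero_ne_one, Nat.reduceEqDiff, OfNat.zero_ne_ofNat, OfNat.one_ne_ofNat] at this
  obtain ⟨b, hb⟩ := this (fun c _ => by
    obtain ⟨k, hk⟩ := hcon c
    exact ⟨k, fun m hm hPm => hk m hPm hm⟩)
  obtain ⟨n, hn, hbn⟩ := hcof b
  obtain ⟨k, hk, hk2⟩ := hb (f n) (ha n hn)
  exact hk2 n (lt_trans hk hbn) ⟨hn, rfl⟩

theorem exists_cofinal_const_or_le (hR : RCA0 (str M) X) (hne : X.Nonempty)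
    (hB : BSigmaSO (str M) X 2) {P : M → Prop} (hP : Cd X P)
    (hcof : Cofinal (str M) {n | P n}) {f : M → M} (hf : Fn X f) (a : M) :
    ∃ Q : M → Prop, Cd X Q ∧ Cofinal (str M) {n | Q n} ∧ (∀ n, Q n → P n) ∧
      ((∃ c, ∀ n, Q n → f n = c) ∨ ∀ n, Q n → a ≤ f n) := by
  have hlt := Cd.lt hR hne hf (fn_const hR hne a)
  by_cases h : Cofinal (str M) {n | P n ∧ f n < a}
  · obtain ⟨c, hc⟩ := exists_cofinal_fiber hR hne hB (hP.and hR hlt) h hf a (fun n hn => hn.2)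
    exact ⟨_, (hP.and hR hlt).and hR (Cd.eq hR hne hf (fn_const hR hne c)), hc,
      fun n hn => hn.1.1, Or.inl ⟨c, fun n hn => hn.2⟩⟩
  · refine ⟨_, hP.and hR (hlt.not hR), ?_, fun n hn => hn.1, Or.inr fun n hn => not_lt.1 hn.2⟩
    simp only [Cofinal, not_forall, not_exists, not_and] at h
    obtain ⟨b, hb⟩ := h
    intro b'
    obtain ⟨x, hx, hbx⟩ := hcof (max b b')
    exact ⟨x, ⟨hx, fun hxa => hb x ⟨hx, hxa⟩ (lt_of_le_of_lt (le_max_left _ _) hbx)⟩,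
      lt_of_le_of_lt (le_max_right _ _) hbx⟩

/-- An unbounded `Σ₁` set has an unbounded subset in the second-order universe. -/
theorem exists_cofinal_witness (hR : RCA0 (str M) X) (hne : X.Nonempty)
    {P : M → Prop} (hP : Cd X P) {R : M → M → Prop} (h : Cd X fun n => R (fst n) (snd n))
    (hcof : Cofinal (str M) {n | P n ∧ ∃ s, R n s}) :
    ∃ Q : M → Prop, Cd X Q ∧ Cofinal (str M) {n | Q n} ∧ (∀ n, Q n → P n) ∧
      ∃ g, Fn X g ∧ ∀ n, Q n → R n (g n) := by
  have hid := fn_id hR hne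
  have hs := hid.snd hR hne
  have hf := hid.fst hR hne
  have hm : Cd X fun n => fst n < fst (snd n) ∧ P (fst (snd n)) ∧ R (fst (snd n)) (snd (snd n)) :=
    (Cd.lt hR hne hf (hs.fst hR hne)).and hR
      ((hP.comp hR (hs.fst hR hne)).and hR (h.comp hR hs))
  obtain ⟨p, hp, hp2⟩ := Cd.mu (R := fun n m => n < fst m ∧ P (fst m) ∧ R (fst m) (snd m))
    hR hne hm (fun n => by
      obtain ⟨x, ⟨hx, s, hs⟩, hnx⟩ := hcof n
      exact ⟨pr x s, by simpa using ⟨hnx, hx, hs⟩⟩)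
  have hQ : Cd X fun i => ∃ n < i, i = fst (p n) :=
    Cd.bex (R := fun i n => i = fst (p n)) hR hne
      (Cd.eq hR hne hf ((hp.comp hR hs).fst hR hne)) hid
  have hQR : ∀ i, (∃ n < i, i = fst (p n)) → P i ∧ ∃ s, R i s := by
    rintro i ⟨n, -, rfl⟩
    exact ⟨(hp2 n).1.2.1, _, (hp2 n).1.2.2⟩
  obtain ⟨g, hg, hg2⟩ := Cd.mu (R := fun i s => (∃ n < i, i = fst (p n)) → R i s) hR hne
    ((hQ.comp hR hf).imp hR h) (fun i => by
      by_cases hi : ∃ n < i, i = fst (p n)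
      · obtain ⟨-, s, hs⟩ := hQR i hi
        exact ⟨s, fun _ => hs⟩
      · exact ⟨0, fun h => absurd h hi⟩)
  refine ⟨_, hQ, ?_, fun i hi => (hQR i hi).1, g, hg, fun i hi => (hg2 i).1 hi⟩
  intro b
  exact ⟨fst (p b), ⟨b, (hp2 b).1.1, rfl⟩, (hp2 b).1.1⟩

/-- Uniform choice of unrefuted elements, by separation. -/
theorem exists_unrefuted (hR : RCA0 (str M) X) (hne : X.Nonempty) (hS : Sigma1Sep (str M) X)
    {D : M → M → M → Prop} (hD : Cd X fun n => D (fst (fst n)) (snd (fst n)) (snd n))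
    (hmono : ∀ i x s s', s ≤ s' → D i x s → D i x s') {α : M → M} (hα : Fn X α)
    (hex : ∀ i, ∃ x < α i, ∀ s, ¬ D i x s) :
    ∃ h, Fn X h ∧ ∀ i, h i < α i ∧ ∀ s, ¬ D i (h i) s := by
  have hid := fn_id hR hne
  have hs := hid.snd hR hne
  have hf := hid.fst hR hne
  have hff := hf.fst hR hne
  have hfs := hf.snd hR hne
  have hL : Cd X fun n => ∀ y < α (fst (fst n)), snd (fst n) < y → D (fst (fst n)) y (snd n) := by
    refine Cd.ball (R := fun n y => snd (fst n) < y → D (fst (fst n)) y (snd n)) hR hne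
      ((Cd.lt hR hne (hff.snd hR hne) hs).imp hR ?_) (hα.comp hR hff)
    simpa using hD.comp hR (((hff.fst hR hne).pr hR hs).pr hR hfs)
  obtain ⟨A, hA, hA2⟩ := hS (.ex 1 (.mem (prT (.var 0) (.var 1)) 0))
    (.ex 1 (.mem (prT (.var 0) (.var 1)) 1))
    (.ex _ (.delta0 (by repeat constructor))) (.ex _ (.delta0 (by repeat constructor)))
    (fun _ => (0 : M)) _ (two_mem (hD.and hR (hL.not hR)) (hL.and hR (hD.not hR))) 0 (by
      intro m
      simp only [Sat, tval, tval_prT, upd, two, Set.mem_ofPred_eq, fst_pr, snd_pr, reduceIte,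
        zero_ne_one, one_ne_zero]
      rintro ⟨⟨s, hs1, hs2⟩, s', hs3, hs4⟩
      rcases le_total s s' with hle | hle
      · exact hs4 (hmono _ _ _ _ hle hs1)
      · exact hs2 fun y hy hyx => hmono _ _ _ _ hle (hs3 y hy hyx))
  simp only [Sat, tval, tval_prT, upd, two, Set.mem_ofPred_eq, fst_pr, snd_pr, reduceIte,
    zero_ne_one, one_ne_zero] at hA2
  have hfalse : ∀ i x s, (∀ x' < x, pr i x' ∈ A) → (∀ y < α i, x ≤ y → D i y s) → False := by
    intro i x s hx hy
    have hC : Cd X fun x => ∀ y < α i, x ≤ y → D i y s := by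
      refine Cd.ball (R := fun x y => x ≤ y → D i y s) (f := fun _ => α i) hR hne ?_
        (fn_const hR hne _)
      have h1 := (Cd.lt hR hne hs hf).not hR
      simp only [not_lt] at h1
      refine h1.imp hR ?_
      simpa using hD.comp hR (((fn_const hR hne i).pr hR hs).pr hR (fn_const hR hne s))
    obtain ⟨x₁, h1, h2⟩ := hC.exists_least hR ⟨x, hy⟩
    have hle : x₁ ≤ x := not_lt.1 fun hlt => h2 x hlt hy
    rcases eq_zero_or_succ x₁ with rfl | ⟨x₂, rfl⟩
    · obtain ⟨y, hy, hyD⟩ := hex i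
      exact hyD s (h1 y hy (zero_le))
    · have hlt : x₂ < x := lt_of_lt_of_le (lt_add_one x₂) hle
      refine (hA2 (pr i x₂)).2 (hx x₂ hlt) ⟨s, ?_, ?_⟩
      · rw [fst_pr, snd_pr]
        exact fun y hy hxy => h1 y hy (DiscreteOrd.succ_le _ _ hxy)
      · rw [fst_pr, snd_pr]
        intro hd
        refine h2 x₂ (lt_add_one x₂) fun y hy hxy => ?_
        rcases hxy.eq_or_lt with rfl | hxy
        · exact hd
        · exact h1 y hy (DiscreteOrd.succ_le _ _ hxy)
  have hA' : Cd X fun n => n ∈ A := hA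
  obtain ⟨h, hh, hh2⟩ := Cd.mu (R := fun i x => x < α i ∧ pr i x ∉ A) hR hne
    ((Cd.lt hR hne hs (hα.comp hR hf)).and hR ((hA'.not hR).comp hR (hf.pr hR hs))) (fun i => by
      by_contra hcon
      push Not at hcon
      exact hfalse i (α i) 0 hcon (fun y hy hy' => absurd hy (not_lt.2 hy')))
  refine ⟨h, hh, fun i => ⟨(hh2 i).1.1, fun s hs => ?_⟩⟩
  refine hfalse i (h i) s (fun x' hx' => ?_) (fun y hy hle => ?_)
  · by_contra hx
    exact (hh2 i).2 x' hx' ⟨lt_trans hx' (hh2 i).1.1, hx⟩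
  · rcases hle.eq_or_lt with rfl | hlt
    · exact hs
    · by_contra hyD
      refine (hh2 i).1.2 ((hA2 _).1 ⟨s, ?_⟩)
      rw [fst_pr, snd_pr]
      exact ⟨hs, fun hall => hyD (hall y hy hlt)⟩

theorem exists_cofinal_bound_or_unrefuted (hW : WKL0 (str M) X) (hne : X.Nonempty)
    (hB : BSigmaSO (str M) X 2) {P : M → Prop} (hP : Cd X P) (hcof : Cofinal (str M) {n | P n})
    {D : M → M → M → Prop} (hD : Cd X fun n => D (fst (fst n)) (snd (fst n)) (snd n))
    {α : M → M} (hα : Fn X α) :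
    ∃ Q : M → Prop, Cd X Q ∧ Cofinal (str M) {n | Q n} ∧ (∀ n, Q n → P n) ∧
      ((∃ g, Fn X g ∧ ∀ i, Q i → ∀ x < α i, ∃ s < g i, D i x s) ∨
        ∃ h, Fn X h ∧ ∀ i, Q i → h i < α i ∧ ∀ s, ¬ D i (h i) s) := by
  have hR := hW.1
  have hid := fn_id hR hne
  have hs := hid.snd hR hne
  have hf := hid.fst hR hne
  have hff := hf.fst hR hne
  have hfs := hf.snd hR hne
  have hbd : Cd X fun n => ∃ t < snd n, D (fst (fst n)) (snd (fst n)) t := by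
    refine Cd.bex (R := fun n t => D (fst (fst n)) (snd (fst n)) t) hR hne ?_ hs
    simpa using hD.comp hR (hf.fst hR hne |>.pr hR hs)
  have hT : Cd X fun n => ∀ x < α (fst n), ∃ t < snd n, D (fst n) x t := by
    refine Cd.ball (R := fun n x => ∃ t < snd n, D (fst n) x t) hR hne ?_ (hα.comp hR hf)
    simpa using hbd.comp hR ((hff.pr hR hs).pr hR hfs)
  by_cases h : Cofinal (str M) {n | P n ∧ ∃ s, ∀ x < α n, ∃ t < s, D n x t}
  · obtain ⟨Q, hQ, hQc, hQP, g, hg, hg2⟩ := exists_cofinal_witness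
      (R := fun n s => ∀ x < α n, ∃ t < s, D n x t) hR hne hP hT h
    exact ⟨Q, hQ, hQc, hQP, Or.inl ⟨g, hg, hg2⟩⟩
  · simp only [Cofinal, not_forall, not_exists, not_and] at h
    obtain ⟨c, hc⟩ := h
    have hQ := hP.and hR (Cd.lt hR hne (fn_const hR hne c) hid)
    obtain ⟨g, hg, hg2⟩ := exists_unrefuted
      (D := fun i x s => (P i ∧ c < i) ∧ (α i ≤ x ∨ ∃ t < s, D i x t)) (α := fun i => α i + 1)
      hR hne hW.2 (by
        refine (hQ.comp hR hff).and hR (Cd.or hR ?_ hbd)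
        simpa using (Cd.lt hR hne hfs (hα.comp hR hff)).not hR)
      (by
        rintro i x s s' hle ⟨h1, h2⟩
        refine ⟨h1, h2.imp_right ?_⟩
        rintro ⟨t, ht, hD⟩
        exact ⟨t, lt_of_lt_of_le ht hle, hD⟩)
      (hα.add hR hne (fn_const hR hne 1)) (by
        intro i
        by_cases hi : P i ∧ c < i
        · by_contra hcon
          push Not at hcon
          obtain ⟨b, hb⟩ := exists_bound (R := fun x t => D i x t) hB (by
            simpa using hD.comp hR (((fn_const hR hne i).pr hR hf).pr hR hs)) (α i) (by
              intro x hx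
              obtain ⟨s, -, h | ⟨t, -, ht⟩⟩ := hcon x (lt_trans hx (lt_add_one _))
              · exact absurd hx (not_lt.2 h)
              · exact ⟨t, ht⟩)
          exact hc i ⟨hi.1, b, hb⟩ hi.2
        · exact ⟨0, lt_add_one_iff_le.2 (zero_le), fun s hs => hi hs.1⟩)
    refine ⟨_, hQ, ?_, fun n hn => hn.1, Or.inr ⟨g, hg, fun i hi => ⟨?_, fun s hs => ?_⟩⟩⟩
    · intro b
      obtain ⟨x, hx, hbx⟩ := hcof (max b c)
      exact ⟨x, ⟨hx, lt_of_le_of_lt (le_max_right _ _) hbx⟩, lt_of_le_of_lt (le_max_left _ _) hbx⟩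
    · by_contra hle
      exact (hg2 i).2 0 ⟨hi, Or.inl (not_lt.1 hle)⟩
    · exact (hg2 i).2 (s + 1) ⟨hi, Or.inr ⟨s, lt_add_one s, hs⟩⟩

end Density

/-! ## Variables of formulas -/

/-- A strict upper bound for the variables of a term. -/
def Term.bd : Term → ℕ
  | .var i => i + 1
  | .zero => 0
  | .one => 0
  | .add t u => max t.bd u.bd
  | .mul t u => max t.bd u.bd

/-- A strict upper bound for the number variables of a formula. -/
def Fml.bd : Fml → ℕ
  | .eq t u => max t.bd u.bd
  | .lt t u => max t.bd u.bd
  | .mem t _ => t.bd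
  | .not φ => φ.bd
  | .and φ ψ => max φ.bd ψ.bd
  | .or φ ψ => max φ.bd ψ.bd
  | .imp φ ψ => max φ.bd ψ.bd
  | .all x φ => max (x + 1) φ.bd
  | .ex x φ => max (x + 1) φ.bd
  | .ball x t φ => max (x + 1) (max t.bd φ.bd)
  | .bex x t φ => max (x + 1) (max t.bd φ.bd)
  | .sall _ φ => φ.bd
  | .sex _ φ => φ.bd

theorem tval_congr {S : Str} {v v' : ℕ → S.M} (t : Term) (h : ∀ i < t.bd, v i = v' i) :
    tval S v t = tval S v' t := by
  induction t with
  | var i => exact h i (Nat.lt_succ_self i)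
  | zero => rfl
  | one => rfl
  | add t u iht ihu =>
    simp only [tval]
    rw [iht fun i hi => h i (lt_max_of_lt_left hi), ihu fun i hi => h i (lt_max_of_lt_right hi)]
  | mul t u iht ihu =>
    simp only [tval]
    rw [iht fun i hi => h i (lt_max_of_lt_left hi), ihu fun i hi => h i (lt_max_of_lt_right hi)]

theorem upd_congr {α : Type} {v v' : ℕ → α} {n : ℕ} (x : ℕ) (m : α)
    (h : ∀ i < n, v i = v' i) : ∀ i < n, upd v x m i = upd v' x m i := by
  intro i hi
  unfold upd
  split_ifs
  · rfl
  · exact h i hi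

theorem sat_congr {S : Str} {X : Set (Set S.M)} (φ : Fml) {v v' : ℕ → S.M} {w : ℕ → Set S.M}
    (h : ∀ i < φ.bd, v i = v' i) : Sat S X v w φ ↔ Sat S X v' w φ := by
  induction φ generalizing v v' w with
  | eq t u | lt t u =>
    simp only [Sat]
    rw [tval_congr t fun i hi => h i (lt_max_of_lt_left hi),
      tval_congr u fun i hi => h i (lt_max_of_lt_right hi)]
  | mem t k =>
    simp only [Sat]
    rw [tval_congr t h]
  | not φ ih =>
    simp only [Sat]
    rw [ih h]
  | and φ ψ ih ih' | or φ ψ ih ih' | imp φ ψ ih ih' =>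
    simp only [Sat]
    rw [ih fun i hi => h i (lt_max_of_lt_left hi), ih' fun i hi => h i (lt_max_of_lt_right hi)]
  | all x φ ih =>
    exact forall_congr' fun m => ih (upd_congr x m fun i hi => h i (lt_max_of_lt_right hi))
  | ex x φ ih =>
    exact exists_congr fun m => ih (upd_congr x m fun i hi => h i (lt_max_of_lt_right hi))
  | ball x t φ ih =>
    simp only [Sat]
    rw [tval_congr t fun i hi => h i (lt_max_of_lt_right (lt_max_of_lt_left hi))]
    exact forall_congr' fun m => imp_congr_right fun _ =>
      ih (upd_congr x m fun i hi => h i (lt_max_of_lt_right (lt_max_of_lt_right hi)))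
  | bex x t φ ih =>
    simp only [Sat]
    rw [tval_congr t fun i hi => h i (lt_max_of_lt_right (lt_max_of_lt_left hi))]
    exact exists_congr fun m => and_congr_right fun _ =>
      ih (upd_congr x m fun i hi => h i (lt_max_of_lt_right (lt_max_of_lt_right hi)))
  | sall k φ ih => exact forall_congr' fun A => imp_congr_right fun _ => ih h
  | sex k φ ih => exact exists_congr fun A => and_congr_right fun _ => ih h

theorem upd_same {α : Type} (v : ℕ → α) (x : ℕ) (m : α) : upd v x m x = m := if_pos rfl

theorem upd_of_ne {α : Type} (v : ℕ → α) {x i : ℕ} (m : α) (h : i ≠ x) : upd v x m i = v i :=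
  if_neg h

theorem upd_comm {α : Type} (v : ℕ → α) {x y : ℕ} (h : x ≠ y) (a b : α) :
    upd (upd v x a) y b = upd (upd v y b) x a := by
  funext i
  unfold upd
  split_ifs with h1 h2
  · exact absurd (h2.symm.trans h1) h
  all_goals rfl

/-! ## Normal forms of low-level formulas -/

/-- A bounded formula preceded by existential quantifiers. -/
inductive IsEx : Fml → Prop
  | delta0 {φ : Fml} : Delta0SO φ → IsEx φ
  | ex (x : ℕ) {φ : Fml} : IsEx φ → IsEx (.ex x φ)

/-- A bounded formula preceded by universal quantifiers. -/
inductive IsAll : Fml → Prop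
  | delta0 {φ : Fml} : Delta0SO φ → IsAll φ
  | all (x : ℕ) {φ : Fml} : IsAll φ → IsAll (.all x φ)

/-- A bounded formula preceded by existential quantifiers followed by universal ones. -/
inductive IsExAll : Fml → Prop
  | ofAll {φ : Fml} : IsAll φ → IsExAll φ
  | ex (x : ℕ) {φ : Fml} : IsExAll φ → IsExAll (.ex x φ)

theorem SigmaSO.delta0_of_zero {φ : Fml} (h : SigmaSO 0 φ) : Delta0SO φ := by
  cases h with
  | delta0 h => exact h

theorem PiSO.delta0_of_zero {φ : Fml} (h : PiSO 0 φ) : Delta0SO φ := by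
  cases h with
  | delta0 h => exact h

theorem SigmaSO.isEx {φ : Fml} (h : SigmaSO 1 φ) : IsEx φ := by
  induction φ with
  | ex x φ ih =>
    cases h with
    | delta0 h => exact .delta0 h
    | ofPi h => exact .delta0 h.delta0_of_zero
    | ex _ h => exact .ex x (ih h)
  | _ =>
    cases h with
    | delta0 h => exact .delta0 h
    | ofPi h => exact .delta0 h.delta0_of_zero

theorem PiSO.isAll {φ : Fml} (h : PiSO 1 φ) : IsAll φ := by
  induction φ with
  | all x φ ih =>
    cases h with
    | delta0 h => exact .delta0 h
    | ofSigma h => exact .delta0 h.delta0_of_zero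
    | all _ h => exact .all x (ih h)
  | _ =>
    cases h with
    | delta0 h => exact .delta0 h
    | ofSigma h => exact .delta0 h.delta0_of_zero

theorem SigmaSO.isExAll {φ : Fml} (h : SigmaSO 2 φ) : IsExAll φ := by
  induction φ with
  | ex x φ ih =>
    cases h with
    | delta0 h => exact .ofAll (.delta0 h)
    | ofPi h => exact .ofAll h.isAll
    | ex _ h => exact .ex x (ih h)
  | _ =>
    cases h with
    | delta0 h => exact .ofAll (.delta0 h)
    | ofPi h => exact .ofAll h.isAll

/-- Bound the leading existential quantifiers by the variable `b`. -/
def bnd (b : ℕ) : Fml → Fml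
  | .ex z φ => .bex z (.var b) (bnd b φ)
  | φ => φ

theorem bnd_of_delta0 (b : ℕ) {φ : Fml} (h : Delta0SO φ) : bnd b φ = φ := by
  cases h <;> rfl

theorem IsEx.delta0_bnd (b : ℕ) {φ : Fml} (h : IsEx φ) : Delta0SO (bnd b φ) := by
  induction h with
  | delta0 h => rwa [bnd_of_delta0 b h]
  | ex x _ ih => exact .bex x _ ih

section Bounding

variable {M : Type} [CommSemiring M] [LinearOrder M] [IsStrictOrderedRing M]
  [CanonicallyOrderedAdd M] [DiscreteOrd M] {X : Set (Set M)}

theorem IsEx.sat_bnd_mono {b : ℕ} {φ : Fml} (h : IsEx φ) (hb : φ.bd ≤ b) {v v' : ℕ → M}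
    {w : ℕ → Set M} (hv : ∀ i ≠ b, v i = v' i) (hle : v b ≤ v' b)
    (hs : Sat (str M) X v w (bnd b φ)) : Sat (str M) X v' w (bnd b φ) := by
  induction h generalizing v v' with
  | delta0 h =>
    rw [bnd_of_delta0 b h] at hs ⊢
    exact (sat_congr _ fun i hi => hv i (hi.trans_le hb).ne).1 hs
  | ex x h ih =>
    obtain ⟨m, hm, hs⟩ := hs
    have hxb : b ≠ x := (Nat.lt_of_succ_le ((le_max_left _ _).trans hb) : x < b).ne'
    refine ⟨m, lt_of_lt_of_le hm hle, ih ((le_max_right _ _).trans hb) ?_ ?_ hs⟩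
    · intro i hi
      unfold upd
      split_ifs
      · rfl
      · exact hv i hi
    · rwa [upd_of_ne _ _ hxb, upd_of_ne _ _ hxb]

theorem IsEx.sat_of_sat_bnd {b : ℕ} {φ : Fml} (h : IsEx φ) {v : ℕ → M} {w : ℕ → Set M}
    (hs : Sat (str M) X v w (bnd b φ)) : Sat (str M) X v w φ := by
  induction h generalizing v with
  | delta0 h => rwa [bnd_of_delta0 b h] at hs
  | ex x h ih =>
    obtain ⟨m, -, hs⟩ := hs
    exact ⟨m, ih hs⟩

theorem IsEx.sat_iff_exists_bnd {b : ℕ} {φ : Fml} (h : IsEx φ) (hb : φ.bd ≤ b) {v : ℕ → M}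
    {w : ℕ → Set M} :
    Sat (str M) X v w φ ↔ ∃ s : M, Sat (str M) X (upd v b s) w (bnd b φ) := by
  constructor
  · intro hs
    induction h generalizing v with
    | delta0 h =>
      refine ⟨0, ?_⟩
      rw [bnd_of_delta0 b h]
      exact (sat_congr _ fun i hi => (upd_of_ne v _ (hi.trans_le hb).ne).symm).1 hs
    | ex x h ih =>
      obtain ⟨m, hs⟩ := hs
      have hb' := (le_max_right _ _).trans hb
      have hxb : x ≠ b := (Nat.lt_of_succ_le ((le_max_left _ _).trans hb) : x < b).ne
      obtain ⟨s, hs⟩ := ih hb' hs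
      refine ⟨max s (m + 1), m, ?_, ?_⟩
      · simp only [tval, upd_same]
        exact lt_of_lt_of_le (lt_add_one m) (le_max_right _ _)
      · rw [upd_comm _ hxb] at hs
        rw [← upd_comm _ hxb] at hs ⊢
        refine h.sat_bnd_mono hb' ?_ ?_ hs
        · intro i hi
          rw [upd_of_ne _ _ hi, upd_of_ne _ _ hi]
        · rw [upd_same, upd_same]
          exact le_max_left _ _
  · rintro ⟨s, hs⟩
    exact (sat_congr _ fun i hi => upd_of_ne v _ (hi.trans_le hb).ne).1 (h.sat_of_sat_bnd hs)

end Bounding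

/-! ## Restricted ultrapowers -/

open Filter

/-- The germs along `U` of the functions in `F`. -/
abbrev ResUlt {M : Type} [CommSemiring M] (U : Ultrafilter M) (F : Subsemiring (M → M)) : Type :=
  F.map (Germ.coeRingHom (U : Filter M))

section ResUlt

variable {M : Type} [CommSemiring M] [LinearOrder M] [IsStrictOrderedRing M]
  [CanonicallyOrderedAdd M] [DiscreteOrd M] {U : Ultrafilter M} {F : Subsemiring (M → M)}

/-- The class of a function in the restricted ultrapower. -/
def ResUlt.mk (U : Ultrafilter M) {F : Subsemiring (M → M)} (f : F) : ResUlt U F :=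
  ⟨Germ.coeRingHom (U : Filter M) f, Subsemiring.mem_map.2 ⟨f, f.2, rfl⟩⟩

namespace ResUlt

theorem exists_rep (b : ResUlt U F) : ∃ f : F, mk U f = b := by
  obtain ⟨b, hb⟩ := b
  obtain ⟨f, hf, rfl⟩ := Subsemiring.mem_map.1 hb
  exact ⟨⟨f, hf⟩, rfl⟩

theorem mk_eq_mk {f g : F} : mk U f = mk U g ↔ ∀ᶠ i in U, f.1 i = g.1 i :=
  Subtype.ext_iff.trans Germ.coe_eq

theorem mk_lt_mk {f g : F} : mk U f < mk U g ↔ ∀ᶠ i in U, f.1 i < g.1 i := Germ.coe_lt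

theorem mk_le_mk {f g : F} : mk U f ≤ mk U g ↔ ∀ᶠ i in U, f.1 i ≤ g.1 i := Germ.coe_le

theorem mk_add (f g : F) : mk U (f + g) = mk U f + mk U g := rfl

theorem canonicallyOrderedAdd
    (hsub : ∀ f g : F, (∀ᶠ i in U, f.1 i ≤ g.1 i) → ∃ h : F, ∀ᶠ i in U, g.1 i = f.1 i + h.1 i) :
    CanonicallyOrderedAdd (ResUlt U F) where
  exists_add_of_le := by
    intro a b hab
    obtain ⟨f, rfl⟩ := exists_rep a
    obtain ⟨g, rfl⟩ := exists_rep b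
    obtain ⟨h, e⟩ := hsub f g (mk_le_mk.1 hab)
    refine ⟨mk U h, ?_⟩
    rw [← mk_add]
    exact mk_eq_mk.2 e
  le_add_self := by
    intro a b
    obtain ⟨f, rfl⟩ := exists_rep a
    obtain ⟨g, rfl⟩ := exists_rep b
    rw [← mk_add]
    exact mk_le_mk.2 (.of_forall fun i => le_add_self)
  le_self_add := by
    intro a b
    obtain ⟨f, rfl⟩ := exists_rep a
    obtain ⟨g, rfl⟩ := exists_rep b
    rw [← mk_add]
    exact mk_le_mk.2 (.of_forall fun i => le_self_add)

instance : DiscreteOrd (ResUlt U F) where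
  succ_le := by
    intro a b hab
    obtain ⟨f, rfl⟩ := exists_rep a
    obtain ⟨g, rfl⟩ := exists_rep b
    change mk U (f + 1) ≤ _
    exact mk_le_mk.2 ((mk_lt_mk.1 hab).mono fun i hi => DiscreteOrd.succ_le _ _ hi)

/-- The diagonal embedding into the restricted ultrapower. -/
def emb (U : Ultrafilter M) (hF : ∀ a : M, (fun _ => a) ∈ F) : Emb (str M) (str (ResUlt U F)) where
  j a := mk U ⟨fun _ => a, hF a⟩
  inj := fun a b h => by simpa using mk_eq_mk.1 h
  zero := rfl
  one := rfl
  add := fun _ _ => rfl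
  mul := fun _ _ => rfl
  lt_iff := fun a b => by
    change a < b ↔ mk U ⟨fun _ => a, hF a⟩ < mk U ⟨fun _ => b, hF b⟩
    rw [mk_lt_mk]
    simp

theorem isEndExt_emb (hF : ∀ a : M, (fun _ => a) ∈ F)
    (h : ∀ f ∈ F, ∀ a, (∃ c, ∀ᶠ i in U, f i = c) ∨ ∀ᶠ i in U, a < f i) :
    IsEndExt (emb U hF) := by
  intro b hb a
  obtain ⟨⟨f, hf⟩, rfl⟩ := exists_rep b
  rcases h f hf a with ⟨c, hc⟩ | ha
  · refine absurd ⟨c, ?_⟩ hb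
    exact mk_eq_mk.2 (hc.mono fun i hi => hi.symm)
  · exact mk_lt_mk.2 ha

theorem isProper_emb (hF : ∀ a : M, (fun _ => a) ∈ F) {f : M → M} (hf : f ∈ F)
    (h : ∀ a, ∀ᶠ i in U, a < f i) : IsProper (emb U hF) := by
  intro hs
  obtain ⟨a, ha⟩ := hs (mk U ⟨f, hf⟩)
  have ha' : mk U ⟨fun _ => a, hF a⟩ = mk U ⟨f, hf⟩ := ha
  obtain ⟨i, hi, hi'⟩ := ((mk_eq_mk.1 ha').and (h a)).exists
  exact absurd hi hi'.ne

/-- The extension of a subset of `M` to the restricted ultrapower. -/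
def img (U : Ultrafilter M) (F : Subsemiring (M → M)) (A : Set M) : Set (ResUlt U F) :=
  {b | ∃ f : F, mk U f = b ∧ ∀ᶠ i in U, f.1 i ∈ A}

theorem mk_mem_img {f : F} {A : Set M} : mk U f ∈ img U F A ↔ ∀ᶠ i in U, f.1 i ∈ A := by
  constructor
  · rintro ⟨g, hg, h⟩
    filter_upwards [mk_eq_mk.1 hg, h] with i h1 h2
    rwa [← h1]
  · exact fun h => ⟨f, rfl, h⟩

end ResUlt

end ResUlt

/-! ## Łoś's theorem -/

theorem upd_map {α β : Type} (h : α → β) (f : ℕ → α) (x : ℕ) (a : α) :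
    (fun k => h (upd f x a k)) = upd (fun k => h (f k)) x (h a) := by
  funext k
  unfold upd
  split_ifs <;> rfl

section Los

variable {M : Type} [CommSemiring M] [LinearOrder M] [IsStrictOrderedRing M]
  [CanonicallyOrderedAdd M] [DiscreteOrd M] {X : Set (Set M)}

/-- The semiring of functions in the second-order universe. -/
def fnRing (hR : RCA0 (str M) X) (hne : X.Nonempty) : Subsemiring (M → M) where
  carrier := {f | Fn X f}
  zero_mem' := fn_const hR hne 0
  one_mem' := fn_const hR hne 1
  add_mem' := fun hf hg => hf.add hR hne hg
  mul_mem' := fun hf hg => hf.mul hR hne hg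

variable {hR : RCA0 (str M) X} {hne : X.Nonempty}

theorem upd_fn (f : ℕ → fnRing hR hne) (x : ℕ) (g : fnRing hR hne) (i : M) :
    (fun k => (upd f x g k).1 i) = upd (fun k => (f k).1 i) x (g.1 i) :=
  upd_map (fun g : fnRing hR hne => g.1 i) f x g

/-- The function given by a term. -/
def Term.fn (f : ℕ → fnRing hR hne) : Term → fnRing hR hne
  | .var i => f i
  | .zero => 0
  | .one => 1
  | .add t u => t.fn f + u.fn f
  | .mul t u => t.fn f * u.fn f

theorem tval_apply (f : ℕ → fnRing hR hne) (i : M) (t : Term) :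
    tval (str M) (fun k => (f k).1 i) t = (t.fn f).1 i := by
  induction t with
  | var _ | zero | one => rfl
  | add t u iht ihu | mul t u iht ihu =>
    simp only [tval, iht, ihu]
    rfl

theorem cd_eq (f g : fnRing hR hne) : Cd X fun i => f.1 i = g.1 i := Cd.eq hR hne f.2 g.2

theorem cd_lt (f g : fnRing hR hne) : Cd X fun i => f.1 i < g.1 i := Cd.lt hR hne f.2 g.2

/-- Precomposition. -/
def compFn (f g : fnRing hR hne) : fnRing hR hne := ⟨fun i => f.1 (g.1 i), f.2.comp hR g.2⟩

variable (hR hne) in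
/-- The first projection. -/
noncomputable def fstFn : fnRing hR hne := ⟨_, (fn_id hR hne).fst hR hne⟩

variable (hR hne) in
/-- The second projection. -/
noncomputable def sndFn : fnRing hR hne := ⟨_, (fn_id hR hne).snd hR hne⟩

theorem cd_sat_upd {φ : Fml} {w : ℕ → Set M}
    (h : ∀ f : ℕ → fnRing hR hne, Cd X fun i => Sat (str M) X (fun k => (f k).1 i) w φ)
    (f : ℕ → fnRing hR hne) (x : ℕ) :
    Cd X fun n => Sat (str M) X (upd (fun k => (f k).1 (fst n)) x (snd n)) w φ := by
  have := h (upd (fun k => compFn (f k) (fstFn hR hne)) x (sndFn hR hne))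
  simp only [upd_fn] at this
  exact this

theorem cd_sat {φ : Fml} (hφ : Delta0SO φ) {w : ℕ → Set M} (hw : ∀ k, w k ∈ X)
    (f : ℕ → fnRing hR hne) : Cd X fun i => Sat (str M) X (fun k => (f k).1 i) w φ := by
  induction hφ generalizing f with
  | eq t u =>
    simp only [Sat, tval_apply]
    exact cd_eq _ _
  | lt t u =>
    simp only [Sat, tval_apply]
    exact cd_lt _ _
  | mem t i =>
    simp only [Sat, tval_apply]
    exact Cd.comp (P := fun n => n ∈ w i) hR (hw i) (t.fn f).2
  | not _ ih => exact (ih f).not hR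
  | and _ _ ih ih' => exact (ih f).and hR (ih' f)
  | or _ _ ih ih' => exact (ih f).or hR (ih' f)
  | imp _ _ ih ih' => exact (ih f).imp hR (ih' f)
  | ball x t _ ih =>
    simp only [Sat, tval_apply]
    exact Cd.ball hR hne (cd_sat_upd ih f x) (t.fn f).2
  | bex x t _ ih =>
    simp only [Sat, tval_apply]
    exact Cd.bex hR hne (cd_sat_upd ih f x) (t.fn f).2

theorem exists_least_fn {P : M → M → Prop} (hP : Cd X fun n => P (fst n) (snd n))
    (α : fnRing hR hne) :
    ∃ g : fnRing hR hne, ∀ i, (∃ m < α.1 i, P i m) →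
      g.1 i < α.1 i ∧ P i (g.1 i) ∧ ∀ m < g.1 i, ¬ P i m := by
  have h1 : Cd X fun n : M => ∃ m < α.1 (fst n), P (fst n) m :=
    (Cd.bex hR hne hP α.2).comp hR ((fn_id hR hne).fst hR hne)
  have h2 := cd_lt (sndFn hR hne) (compFn α (fstFn hR hne))
  obtain ⟨g, hg, h⟩ := Cd.mu (R := fun i m => (∃ m < α.1 i, P i m) → m < α.1 i ∧ P i m) hR hne
    (h1.imp hR (h2.and hR hP)) (fun i => by
      by_cases h : ∃ m < α.1 i, P i m
      · obtain ⟨m, hm⟩ := h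
        exact ⟨m, fun _ => hm⟩
      · exact ⟨0, fun h' => absurd h' h⟩)
  refine ⟨⟨g, hg⟩, fun i hi => ⟨((h i).1 hi).1, ((h i).1 hi).2, fun m hm hPm => ?_⟩⟩
  exact (h i).2 m hm fun _ => ⟨hm.trans ((h i).1 hi).1, hPm⟩

variable {U : Ultrafilter M}

open ResUlt

theorem canonicallyOrderedAdd_fnRing : CanonicallyOrderedAdd (ResUlt U (fnRing hR hne)) := by
  refine canonicallyOrderedAdd fun f g hfg => ?_
  obtain ⟨h, hh⟩ := exists_least_fn (P := fun i m => g.1 i = f.1 i + m)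
    (cd_eq (compFn g (fstFn hR hne)) (compFn f (fstFn hR hne) + sndFn hR hne)) (g + 1)
  refine ⟨h, hfg.mono fun i hi => (hh i ?_).2.1⟩
  obtain ⟨c, hc⟩ := exists_add_of_le hi
  exact ⟨c, lt_add_one_iff_le.2 (hc ▸ le_add_self), hc⟩

theorem tval_mk (f : ℕ → fnRing hR hne) (t : Term) :
    tval (str (ResUlt U (fnRing hR hne))) (fun k => mk U (f k)) t = mk U (t.fn f) := by
  induction t with
  | var _ | zero | one => rfl
  | add t u iht ihu | mul t u iht ihu =>
    simp only [tval, iht, ihu]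
    rfl

variable {Y : Set (Set (ResUlt U (fnRing hR hne)))} {w : ℕ → Set M}

theorem sat_mk_bex_iff {φ : Fml} (hφ : Delta0SO φ) (hw : ∀ k, w k ∈ X)
    (ih : ∀ f : ℕ → fnRing hR hne,
      Sat (str (ResUlt U (fnRing hR hne))) Y (fun k => mk U (f k)) (fun k => img U _ (w k)) φ ↔
        ∀ᶠ i in U, Sat (str M) X (fun k => (f k).1 i) w φ)
    (x : ℕ) (t : Term) (f : ℕ → fnRing hR hne) :
    Sat (str (ResUlt U (fnRing hR hne))) Y (fun k => mk U (f k)) (fun k => img U _ (w k))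
        (.bex x t φ) ↔
      ∀ᶠ i in U, Sat (str M) X (fun k => (f k).1 i) w (.bex x t φ) := by
  simp only [Sat, tval_apply, tval_mk]
  constructor
  · rintro ⟨m, hm, hs⟩
    obtain ⟨g, rfl⟩ := exists_rep m
    rw [← upd_map, ih] at hs
    filter_upwards [mk_lt_mk.1 hm, hs] with i h1 h2
    rw [upd_fn] at h2
    exact ⟨g.1 i, h1, h2⟩
  · intro h
    obtain ⟨g, hg⟩ := exists_least_fn
      (P := fun i m => Sat (str M) X (upd (fun k => (f k).1 i) x m) w φ)
      (cd_sat_upd (cd_sat hφ hw) f x) (t.fn f)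
    refine ⟨mk U g, mk_lt_mk.2 (h.mono fun i hi => (hg i hi).1), ?_⟩
    rw [← upd_map, ih]
    filter_upwards [h] with i hi
    rw [upd_fn]
    exact (hg i hi).2.1

theorem sat_mk_iff {φ : Fml} (hφ : Delta0SO φ) (hw : ∀ k, w k ∈ X) (f : ℕ → fnRing hR hne) :
    Sat (str (ResUlt U (fnRing hR hne))) Y (fun k => mk U (f k)) (fun k => img U _ (w k)) φ ↔
      ∀ᶠ i in U, Sat (str M) X (fun k => (f k).1 i) w φ := by
  induction hφ generalizing f with
  | eq t u =>
    simp only [Sat, tval_apply, tval_mk]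
    exact mk_eq_mk
  | lt t u =>
    simp only [Sat, tval_apply, tval_mk]
    exact mk_lt_mk
  | mem t i =>
    simp only [Sat, tval_apply, tval_mk]
    exact mk_mem_img
  | not _ ih =>
    simp only [Sat, ih]
    exact Ultrafilter.eventually_not.symm
  | and _ _ ih ih' =>
    simp only [Sat, ih, ih']
    exact eventually_and.symm
  | or _ _ ih ih' =>
    simp only [Sat, ih, ih']
    exact Ultrafilter.eventually_or.symm
  | imp _ _ ih ih' =>
    simp only [Sat, ih, ih']
    exact Ultrafilter.eventually_imp.symm
  | bex x t h ih => exact sat_mk_bex_iff h hw ih x t f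
  | ball x t h ih =>
    have := sat_mk_bex_iff (U := U) (Y := Y) h.not hw (fun f => by
      simp only [Sat, ih]
      exact Ultrafilter.eventually_not.symm) x t f
    simp only [Sat] at this ⊢
    rw [← not_iff_not, ← Ultrafilter.eventually_not]
    push Not
    exact this

/-! ## Elementarity -/

theorem IsEx.exists_fn {φ : Fml} (hφ : IsEx φ) (hw : ∀ k, w k ∈ X) (f : ℕ → fnRing hR hne)
    (x : ℕ) (h : ∀ i, ∃ m, Sat (str M) X (upd (fun k => (f k).1 i) x m) w φ) :
    ∃ g : fnRing hR hne, ∀ i, Sat (str M) X (upd (fun k => (f k).1 i) x (g.1 i)) w φ := by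
  let b := φ.bd
  have hcd := cd_sat (hφ.delta0_bnd b) hw
    (upd (upd (fun k => compFn (f k) (fstFn hR hne)) x (compFn (fstFn hR hne) (sndFn hR hne))) b
      (compFn (sndFn hR hne) (sndFn hR hne)))
  simp only [upd_fn] at hcd
  obtain ⟨g, hg, hs⟩ := Cd.mu (R := fun i t => Sat (str M) X
      (upd (upd (fun k => (f k).1 i) x (PaperArith.fst t)) b (PaperArith.snd t)) w (bnd b φ))
    hR hne hcd (fun i => by
      obtain ⟨m, hm⟩ := h i
      obtain ⟨s, hs⟩ := (hφ.sat_iff_exists_bnd le_rfl).1 hm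
      exact ⟨pr m s, by simpa using hs⟩)
  exact ⟨compFn (fstFn hR hne) ⟨g, hg⟩, fun i => (hφ.sat_iff_exists_bnd le_rfl).2
    ⟨_, (hs i).1⟩⟩

theorem IsEx.sat_mk {φ : Fml} (hφ : IsEx φ) (hw : ∀ k, w k ∈ X) (f : ℕ → fnRing hR hne)
    (h : ∀ i, Sat (str M) X (fun k => (f k).1 i) w φ) :
    Sat (str (ResUlt U (fnRing hR hne))) Y (fun k => mk U (f k)) (fun k => img U _ (w k)) φ := by
  induction hφ generalizing f with
  | delta0 hφ => exact (sat_mk_iff hφ hw f).2 (.of_forall h)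
  | ex x hφ ih =>
    obtain ⟨g, hg⟩ := hφ.exists_fn hw f x h
    refine ⟨mk U g, ?_⟩
    rw [← upd_map]
    refine ih _ fun i => ?_
    rw [upd_fn]
    exact hg i

theorem IsAll.sat_mk {φ : Fml} (hφ : IsAll φ) (hw : ∀ k, w k ∈ X) (f : ℕ → fnRing hR hne)
    (h : ∀ i, Sat (str M) X (fun k => (f k).1 i) w φ) :
    Sat (str (ResUlt U (fnRing hR hne))) Y (fun k => mk U (f k)) (fun k => img U _ (w k)) φ := by
  induction hφ generalizing f with
  | delta0 hφ => exact (sat_mk_iff hφ hw f).2 (.of_forall h)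
  | all x hφ ih =>
    intro m
    obtain ⟨g, rfl⟩ := exists_rep m
    rw [← upd_map]
    refine ih _ fun i => ?_
    rw [upd_fn]
    exact h i _

/-- Negation, pushed through the leading universal quantifiers. -/
def neg : Fml → Fml
  | .all x φ => .ex x (neg φ)
  | φ => .not φ

theorem neg_of_delta0 {φ : Fml} (h : Delta0SO φ) : neg φ = .not φ := by
  cases h <;> rfl

theorem IsAll.isEx_neg {φ : Fml} (h : IsAll φ) : IsEx (neg φ) := by
  induction h with
  | delta0 h =>
    rw [neg_of_delta0 h]
    exact .delta0 h.not
  | all x _ ih => exact .ex x ih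

theorem IsAll.sat_neg {S : Str} {Z : Set (Set S.M)} {φ : Fml} (h : IsAll φ) (v : ℕ → S.M)
    (w : ℕ → Set S.M) : Sat S Z v w (neg φ) ↔ ¬ Sat S Z v w φ := by
  induction h generalizing v with
  | delta0 h =>
    rw [neg_of_delta0 h]
    rfl
  | all x _ ih => simp only [neg, Sat, ih, not_forall]

theorem IsExAll.not_sat_mk {φ : Fml} (hφ : IsExAll φ) (hw : ∀ k, w k ∈ X)
    (f : ℕ → fnRing hR hne) (h : ∀ i, ¬ Sat (str M) X (fun k => (f k).1 i) w φ) :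
    ¬ Sat (str (ResUlt U (fnRing hR hne))) Y (fun k => mk U (f k)) (fun k => img U _ (w k)) φ := by
  induction hφ generalizing f with
  | ofAll hφ =>
    rw [← hφ.sat_neg]
    exact hφ.isEx_neg.sat_mk hw f fun i => (hφ.sat_neg _ _).2 (h i)
  | ex x hφ ih =>
    rintro ⟨m, hm⟩
    obtain ⟨g, rfl⟩ := exists_rep m
    rw [← upd_map] at hm
    refine ih _ (fun i => ?_) hm
    rw [upd_fn]
    exact fun hs => h i ⟨_, hs⟩

theorem const_mem_fnRing (a : M) : (fun _ => a) ∈ fnRing hR hne := fn_const hR hne a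

theorem IsExAll.sat_emb_iff {φ : Fml} (hφ : IsExAll φ) (hw : ∀ k, w k ∈ X) (v : ℕ → M) :
    Sat (str M) X v w φ ↔ Sat (str (ResUlt U (fnRing hR hne))) Y
      (fun k => (emb U const_mem_fnRing).j (v k)) (fun k => img U _ (w k)) φ := by
  refine ⟨fun h => ?_, fun h => ?_⟩
  · induction hφ generalizing v with
    | ofAll hφ => exact hφ.sat_mk hw (fun k => ⟨fun _ => v k, const_mem_fnRing _⟩) fun _ => h
    | ex x _ ih =>
      obtain ⟨m, hm⟩ := h
      refine ⟨(emb U const_mem_fnRing).j m, ?_⟩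
      rw [← upd_map (emb U const_mem_fnRing).j]
      exact ih _ hm
  · by_contra hn
    exact hφ.not_sat_mk hw (fun k => ⟨fun _ => v k, const_mem_fnRing _⟩) (fun _ => hn) h

end Los

/-! ## Generic ultrafilters -/

theorem exists_generic_ultrafilter {α ι : Type} [Nonempty ι] [Countable ι] {P : Set α → Prop}
    (hP : ∃ A, P A) (hne : ∀ A, P A → A.Nonempty) (R : ι → Set α → Prop)
    (hR : ∀ k A, P A → ∃ B, P B ∧ B ⊆ A ∧ R k B) :
    ∃ U : Ultrafilter α, ∀ k, ∃ B ∈ U, R k B := by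
  obtain ⟨e, he⟩ := exists_surjective_nat ι
  choose! s hs using hR
  obtain ⟨A, hA⟩ := hP
  let T : ℕ → Set α := fun n => n.rec A fun n B => s (e n) B
  have hT : ∀ n, P (T n) := fun n => by
    induction n with
    | zero => exact hA
    | succ n ih => exact (hs (e n) _ ih).1
  have hanti : Antitone T := antitone_nat_of_succ_le fun n => (hs (e n) _ (hT n)).2.1
  have hbot : (⨅ n, 𝓟 (T n)).NeBot :=
    have : Nonempty α := (hne A hA).nonempty
    iInf_neBot_of_directed
      (fun m n => ⟨max m n, principal_mono.2 (hanti (le_max_left _ _)),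
        principal_mono.2 (hanti (le_max_right _ _))⟩)
      fun n => principal_neBot_iff.2 (hne _ (hT n))
  refine ⟨Ultrafilter.of (⨅ n, 𝓟 (T n)), fun k => ?_⟩
  obtain ⟨n, rfl⟩ := he k
  refine ⟨T (n + 1), Ultrafilter.of_le _ ?_, (hs (e n) _ (hT n)).2.2⟩
  exact mem_iInf_of_mem (n + 1) (mem_principal_self _)

section Generic

variable {M : Type} [CommSemiring M] [LinearOrder M] [IsStrictOrderedRing M]
  [CanonicallyOrderedAdd M] [DiscreteOrd M] {X : Set (Set M)}

theorem fn_injective_graph : Function.Injective fun f : M → M => {n : M | ∃ x, n = pr x (f x)} := by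
  intro f g h
  funext x
  have hx : pr x (f x) ∈ {n : M | ∃ x, n = pr x (g x)} := by
    have h' : {n | ∃ x, n = pr x (f x)} = {n | ∃ x, n = pr x (g x)} := h
    rw [← h']
    exact ⟨x, rfl⟩
  exact pr_mem_graph.1 hx

/-- The properties of a generic ultrafilter. -/
structure IsGeneric (X : Set (Set M)) (U : Ultrafilter M) : Prop where
  lt_id : ∀ a : M, ∀ᶠ i in (U : Filter M), a < i
  const_or_le : ∀ f, Fn X f → ∀ a, (∃ c, ∀ᶠ i in U, f i = c) ∨ ∀ᶠ i in U, a ≤ f i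
  bound_or_unrefuted : ∀ D : M → M → M → Prop,
    (Cd X fun n => D (fst (fst n)) (snd (fst n)) (snd n)) → ∀ α, Fn X α →
      (∃ g, Fn X g ∧ ∀ᶠ i in U, ∀ x < α i, ∃ s < g i, D i x s) ∨
        ∃ h, Fn X h ∧ ∀ᶠ i in U, h i < α i ∧ ∀ s, ¬ D i (h i) s

theorem exists_isGeneric [Countable M] (hcX : X.Countable) (hne : X.Nonempty)
    (hB : BSigmaSO (str M) X 2) (hW : WKL0 (str M) X) : ∃ U, IsGeneric X U := by
  have hR := hW.1
  have := hcX.to_subtype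
  have : Countable {f : M → M // Fn X f} :=
    Function.Injective.countable (f := fun f => (⟨_, f.2⟩ : X)) fun f g h =>
      Subtype.ext (fn_injective_graph (Subtype.ext_iff.1 h))
  have : Nonempty {f : M → M // Fn X f} := ⟨⟨_, fn_id hR hne⟩⟩
  obtain ⟨U, hU⟩ := exists_generic_ultrafilter
    (ι := {f : M → M // Fn X f} × M ⊕ {f : M → M // Fn X f} × X)
    (P := fun A => A ∈ X ∧ Cofinal (str M) A)
    ⟨{n | n = n}, Cd.eq hR hne (fn_id hR hne) (fn_id hR hne), fun b =>
      ⟨b + 1, rfl, lt_add_one b⟩⟩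
    (fun A hA => let ⟨x, hx, _⟩ := hA.2 0; ⟨x, hx⟩)
    (Sum.elim
      (fun k A => (∀ n ∈ A, k.2 < n) ∧ ((∃ c, ∀ n ∈ A, k.1.1 n = c) ∨ ∀ n ∈ A, k.2 ≤ k.1.1 n))
      fun k A => (∃ g, Fn X g ∧ ∀ i ∈ A, ∀ x < k.1.1 i, ∃ s < g i, pr (pr i x) s ∈ k.2.1) ∨
        ∃ h, Fn X h ∧ ∀ i ∈ A, h i < k.1.1 i ∧ ∀ s, pr (pr i (h i)) s ∉ k.2.1)
    (by
      rintro (⟨⟨f, hf⟩, a⟩ | ⟨⟨α, hα⟩, A, hA⟩) B ⟨hB1, hB2⟩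
      · obtain ⟨Q, hQ, hQc, hQB, h⟩ := exists_cofinal_const_or_le hR hne hB 
          (P := fun n => n ∈ B ∧ a < n)
          (Cd.and hR hB1 (Cd.lt hR hne (fn_const hR hne a) (fn_id hR hne)))
          (fun b => by
            obtain ⟨x, hx, h⟩ := hB2 (max a b)
            have h : max a b < x := h
            exact ⟨x, ⟨hx, (le_max_left _ _).trans_lt h⟩, (le_max_right _ _).trans_lt h⟩) hf a
        exact ⟨{n | Q n}, ⟨hQ, hQc⟩, fun n hn => (hQB n hn).1, fun n hn => (hQB n hn).2, h⟩
      · have hid := fn_id hR hne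
        obtain ⟨Q, hQ, hQc, hQB, h⟩ := exists_cofinal_bound_or_unrefuted hW hne hB
          (P := (· ∈ B)) hB1 hB2 (D := fun i x s => pr (pr i x) s ∈ A)
          (Cd.comp (P := (· ∈ A)) hR hA
            ((((hid.fst hR hne).fst hR hne).pr hR ((hid.fst hR hne).snd hR hne)).pr hR
              (hid.snd hR hne))) hα
        exact ⟨{n | Q n}, ⟨hQ, hQc⟩, hQB, h⟩)
  refine ⟨U, fun a => ?_, fun f hf a => ?_, fun D hD α hα => ?_⟩
  · obtain ⟨B, hB, h, -⟩ := hU (.inl (⟨_, fn_id hR hne⟩, a))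
    exact mem_of_superset hB h
  · obtain ⟨B, hB, -, h⟩ := hU (.inl (⟨f, hf⟩, a))
    exact h.imp (fun ⟨c, hc⟩ => ⟨c, mem_of_superset hB hc⟩) fun h => mem_of_superset hB h
  · obtain ⟨B, hB, h⟩ := hU (.inr (⟨α, hα⟩, ⟨_, hD⟩))
    refine h.imp (fun ⟨g, hg, h⟩ => ⟨g, hg, mem_of_superset hB ?_⟩)
      fun ⟨g, hg, h⟩ => ⟨g, hg, mem_of_superset hB ?_⟩
    all_goals
      intro i hi
      simpa using h i hi

variable {hR : RCA0 (str M) X} {hne : X.Nonempty} {U : Ultrafilter M}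

open ResUlt

theorem exists_img_valuation {w : ℕ → Set (ResUlt U (fnRing hR hne))}
    (hw : ∀ k, w k ∈ img U (fnRing hR hne) '' X) :
    ∃ w' : ℕ → Set M, (∀ k, w' k ∈ X) ∧ w = fun k => img U _ (w' k) := by
  choose w' h1 h2 using hw
  exact ⟨w', h1, funext fun k => (h2 k).symm⟩

theorem exists_mk_valuation (v : ℕ → ResUlt U (fnRing hR hne)) :
    ∃ f : ℕ → fnRing hR hne, v = fun k => mk U (f k) := by
  choose f hf using fun k => exists_rep (v k)
  exact ⟨f, funext fun k => (hf k).symm⟩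

theorem indForSO_resUlt :
    IndForSO (str (ResUlt U (fnRing hR hne))) (img U (fnRing hR hne) '' X) Delta0SO := by
  have := canonicallyOrderedAdd_fnRing (hR := hR) (hne := hne) (U := U)
  intro φ hφ v w hw x h0 hs m
  obtain ⟨w, hwX, rfl⟩ := exists_img_valuation hw
  obtain ⟨f, rfl⟩ := exists_mk_valuation v
  obtain ⟨g, rfl⟩ := exists_rep m
  by_contra hn
  have key : ∀ g : fnRing hR hne, Sat (str (ResUlt U (fnRing hR hne))) (img U (fnRing hR hne) '' X)
      (upd (fun k => mk U (f k)) x (mk U g)) (fun k => img U _ (w k)) φ ↔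
      ∀ᶠ i in U, Sat (str M) X (upd (fun k => (f k).1 i) x (g.1 i)) w φ := by
    intro g
    rw [← upd_map, sat_mk_iff hφ hwX]
    simp only [upd_fn]
  rw [key, ← Ultrafilter.eventually_not] at hn
  obtain ⟨h, hh⟩ := exists_least_fn
    (P := fun i m => ¬ Sat (str M) X (upd (fun k => (f k).1 i) x m) w φ)
    ((cd_sat_upd (cd_sat hφ hwX) f x).not hR) (g + 1)
  have hleast : ∀ᶠ i in U, ¬ Sat (str M) X (upd (fun k => (f k).1 i) x (h.1 i)) w φ ∧
      ∀ m < h.1 i, Sat (str M) X (upd (fun k => (f k).1 i) x m) w φ := by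
    filter_upwards [hn] with i hi
    have := (hh i ⟨g.1 i, lt_add_one _, hi⟩).2
    exact ⟨this.1, fun m hm => not_not.1 (this.2 m hm)⟩
  have hnot : ¬ Sat (str (ResUlt U (fnRing hR hne))) (img U (fnRing hR hne) '' X)
      (upd (fun k => mk U (f k)) x (mk U h)) (fun k => img U _ (w k)) φ := by
    rw [key, ← Ultrafilter.eventually_not]
    exact hleast.mono fun i hi => hi.1
  rcases eq_zero_or_succ (mk U h) with h1 | ⟨d, hd⟩
  · rw [h1] at hnot
    exact hnot h0
  · obtain ⟨p, rfl⟩ := exists_rep d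
    rw [hd] at hnot
    refine hnot (hs _ ((key p).2 ?_))
    filter_upwards [hleast, mk_lt_mk.1 (hd ▸ lt_add_one (mk U p))] with i h1 h2
    exact h1.2 _ h2

theorem collForSO_resUlt (hU : IsGeneric X U) :
    CollForSO (str (ResUlt U (fnRing hR hne))) (img U (fnRing hR hne) '' X) (SigmaSO 1) := by
  have := canonicallyOrderedAdd_fnRing (hR := hR) (hne := hne) (U := U)
  intro φ hφ v w hw x y _ a hex
  obtain ⟨w, hwX, rfl⟩ := exists_img_valuation hw
  obtain ⟨f, rfl⟩ := exists_mk_valuation v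
  obtain ⟨α, rfl⟩ := exists_rep a
  have hψ : IsEx (.ex y φ) := .ex y hφ.isEx
  let b := (Fml.ex y φ).bd
  have hyb : y ≠ b := (Nat.lt_of_succ_le (le_max_left _ _) : y < b).ne
  have key : ∀ g s : fnRing hR hne,
      Sat (str (ResUlt U (fnRing hR hne))) (img U (fnRing hR hne) '' X)
        (upd (upd (fun k => mk U (f k)) x (mk U g)) b (mk U s)) (fun k => img U _ (w k))
        (bnd b (.ex y φ)) ↔
      ∀ᶠ i in U, Sat (str M) X (upd (upd (fun k => (f k).1 i) x (g.1 i)) b (s.1 i)) w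
        (bnd b (.ex y φ)) := by
    intro g s
    rw [← upd_map, ← upd_map, sat_mk_iff (hψ.delta0_bnd b) hwX]
    simp only [upd_fn]
  have hcd := cd_sat (hR := hR) (hne := hne) (hψ.delta0_bnd b) hwX
  have hD := hcd (upd (upd (fun k => compFn (f k) (compFn (fstFn hR hne) (fstFn hR hne))) x
    (compFn (sndFn hR hne) (fstFn hR hne))) b (sndFn hR hne))
  simp only [upd_fn] at hD
  rcases hU.bound_or_unrefuted (fun i m s => Sat (str M) X
      (upd (upd (fun k => (f k).1 i) x m) b s) w (bnd b (.ex y φ))) hD α.1 α.2 with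
    ⟨g, hg, h⟩ | ⟨h, hh, hn⟩
  · refine ⟨mk U ⟨g, hg⟩, fun m hm => ?_⟩
    obtain ⟨μ, rfl⟩ := exists_rep m
    have hP := hcd (upd (upd (fun k => compFn (f k) (fstFn hR hne)) x (compFn μ (fstFn hR hne))) b
      (sndFn hR hne))
    simp only [upd_fn] at hP
    obtain ⟨σ, hσ⟩ := exists_least_fn (P := fun i s => Sat (str M) X
      (upd (upd (fun k => (f k).1 i) x (μ.1 i)) b s) w (bnd b (.ex y φ))) hP ⟨g, hg⟩
    have hσ' := (h.and (mk_lt_mk.1 hm)).mono fun i hi => hσ i (hi.1 _ hi.2)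
    obtain ⟨k, hk, hs⟩ := (key μ σ).2 (hσ'.mono fun i hi => hi.2.1)
    simp only [tval, upd_same] at hk
    refine ⟨k, hk.trans (mk_lt_mk.2 (hσ'.mono fun i hi => hi.1)), ?_⟩
    have hs' := hφ.isEx.sat_of_sat_bnd hs
    rw [← upd_comm _ hyb] at hs'
    exact (sat_congr _ fun i hi => upd_of_ne _ _
      (hi.trans_le (le_max_right _ _ : φ.bd ≤ b)).ne).1 hs'
  · obtain ⟨k, hk⟩ := hex (mk U ⟨h, hh⟩) (mk_lt_mk.2 (hn.mono fun i hi => hi.1))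
    obtain ⟨s, hs⟩ := (hψ.sat_iff_exists_bnd (le_refl b)).1 ⟨k, hk⟩
    obtain ⟨σ, rfl⟩ := exists_rep s
    obtain ⟨i, hi, hi'⟩ := (((key ⟨h, hh⟩ σ).1 hs).and hn).exists
    exact (hi'.2 _ hi).elim

theorem exists_extension_of_nonempty [Countable M] (hcX : X.Countable) (hne : X.Nonempty)
    (hB : BSigmaSO (str M) X 2) (hW : WKL0 (str M) X) :
    ∃ (K : Str) (e : Emb (str M) K) (g : Set M → Set K.M),
      IsProper e ∧ IsEndExt e ∧ (∀ A ∈ X, ∀ a, (e.j a ∈ g A ↔ a ∈ A)) ∧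
      (∀ φ : Fml, SigmaSO 2 φ → ∀ (v : ℕ → M) (w : ℕ → Set M), (∀ k, w k ∈ X) →
        (Sat (str M) X v w φ ↔
          Sat K (g '' X) (fun k => e.j (v k)) (fun k => g (w k)) φ)) ∧
      BSigmaSO K (g '' X) 1 := by
  obtain ⟨U, hU⟩ := exists_isGeneric hcX hne hB hW
  have := canonicallyOrderedAdd_fnRing (hR := hW.1) (hne := hne) (U := U)
  refine ⟨str (ResUlt U (fnRing hW.1 hne)), emb U const_mem_fnRing, img U _,
    isProper_emb _ (fn_id hW.1 hne) hU.lt_id,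
    isEndExt_emb _ fun f hf a => (hU.const_or_le f hf (a + 1)).imp_right fun h =>
      h.mono fun i hi => (lt_add_one a).trans_le hi,
    fun A _ a => mk_mem_img.trans (by simp),
    fun φ hφ v w hw => hφ.isExAll.sat_emb_iff hw v,
    paminus_str, indForSO_resUlt, collForSO_resUlt hU⟩

end Generic

/-! ## The extension by germs of polynomials -/

section Poly

open Polynomial

variable {M : Type} [CommSemiring M] [LinearOrder M] [IsStrictOrderedRing M]
  [CanonicallyOrderedAdd M] [DiscreteOrd M]

/-- `q - p` is eventually constant, or eventually exceeds every constant. -/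
def ConstOrLtSub (p q : M → M) : Prop :=
  (∃ c, ∀ᶠ i in atTop, q i = p i + c) ∨ ∀ a, ∀ᶠ i in atTop, p i + a < q i

theorem ConstOrLtSub.add_id_mul {p q : M → M} (h : ConstOrLtSub p q) (a b : M) :
    ConstOrLtSub (fun i => a + i * p i) (fun i => b + i * q i) ∨
      ConstOrLtSub (fun i => b + i * q i) (fun i => a + i * p i) := by
  have hlt (h : ∀ᶠ i in atTop, p i + 1 ≤ q i) :
      ConstOrLtSub (fun i => a + i * p i) (fun i => b + i * q i) := by
    refine .inr fun c => ?_
    filter_upwards [h, eventually_ge_atTop (a + c + 1)] with i hi hdi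
    calc a + i * p i + c = i * p i + (a + c) := by ring
      _ < i * p i + i := add_lt_add_right ((lt_add_one _).trans_le hdi) _
      _ = i * (p i + 1) := by ring
      _ ≤ i * q i := mul_le_mul_right hi i
      _ ≤ b + i * q i := le_add_self
  rcases h with ⟨c, hc⟩ | h
  · rcases eq_or_ne c 0 with rfl | hc0
    · simp only [add_zero] at hc
      rcases le_total a b with hab | hab
      · obtain ⟨d, rfl⟩ := exists_add_of_le hab
        refine .inl (.inl ⟨d, hc.mono fun i hi => ?_⟩)
        beta_reduce
        rw [hi]
        ring
      · obtain ⟨d, rfl⟩ := exists_add_of_le hab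
        refine .inr (.inl ⟨d, hc.mono fun i hi => ?_⟩)
        beta_reduce
        rw [hi]
        ring
    · have h1 := DiscreteOrd.succ_le 0 c (pos_iff_ne_zero.2 hc0)
      rw [zero_add] at h1
      refine .inl (hlt (hc.mono fun i hi => ?_))
      rw [hi]
      gcongr
  · exact .inl (hlt ((h 1).mono fun i hi => hi.le))

theorem constOrLtSub_eval (n : ℕ) (P Q : M[X]) (hP : P.natDegree ≤ n) (hQ : Q.natDegree ≤ n) :
    ConstOrLtSub (fun i => P.eval i) (fun i => Q.eval i) ∨
      ConstOrLtSub (fun i => Q.eval i) (fun i => P.eval i) := by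
  induction n generalizing P Q with
  | zero =>
    rw [eq_C_of_natDegree_le_zero hP, eq_C_of_natDegree_le_zero hQ]
    simp only [eval_C]
    refine (le_total (P.coeff 0) (Q.coeff 0)).imp (fun h => .inl ?_) fun h => .inl ?_
    all_goals
      obtain ⟨d, hd⟩ := exists_add_of_le h
      exact ⟨d, .of_forall fun _ => hd⟩
  | succ n ih =>
    have hdeg : ∀ P : M[X], P.natDegree ≤ n + 1 → P.divX.natDegree ≤ n := fun P h => by
      rw [natDegree_divX_eq_natDegree_tsub_one]
      omega
    have heval : ∀ P : M[X], (fun i => P.eval i) = fun i => P.coeff 0 + i * P.divX.eval i :=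
      fun P => by
        funext i
        conv_lhs => rw [← P.X_mul_divX_add]
        rw [eval_add, eval_mul, eval_X, eval_C, add_comm]
    rw [heval P, heval Q]
    rcases ih _ _ (hdeg P hP) (hdeg Q hQ) with h | h
    · exact h.add_id_mul _ _
    · exact (h.add_id_mul _ _).symm

/-- The functions that agree almost everywhere with a difference of polynomials. -/
def polySub (U : Ultrafilter M) : Subsemiring (M → M) where
  carrier := {f | ∃ P Q : M[X], ∀ᶠ i in U, f i + Q.eval i = P.eval i}
  zero_mem' := ⟨0, 0, by simp⟩
  one_mem' := ⟨1, 0, by simp⟩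
  add_mem' := by
    rintro f g ⟨P, Q, h⟩ ⟨R, S, h'⟩
    refine ⟨P + R, Q + S, ?_⟩
    filter_upwards [h, h'] with i h h'
    simp only [Pi.add_apply, eval_add, ← h, ← h']
    ring
  mul_mem' := by
    rintro f g ⟨P, Q, h⟩ ⟨R, S, h'⟩
    refine ⟨P * R + Q * S, P * S + R * Q, ?_⟩
    filter_upwards [h, h'] with i h h'
    simp only [Pi.mul_apply, eval_add, eval_mul, ← h, ← h']
    ring

variable {U : Ultrafilter M}

theorem const_mem_polySub (a : M) : (fun _ => a) ∈ polySub U := ⟨C a, 0, by simp⟩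

theorem id_mem_polySub : (fun i => i) ∈ polySub U := ⟨X, 0, by simp⟩

theorem eventually_const_or_lt_of_mem_polySub (hU : (U : Filter M) ≤ atTop) {f : M → M}
    (hf : f ∈ polySub U) (a : M) : (∃ c, ∀ᶠ i in U, f i = c) ∨ ∀ᶠ i in U, a < f i := by
  obtain ⟨P, Q, h⟩ := hf
  rcases constOrLtSub_eval _ Q P (le_max_left _ _) (le_max_right _ _) with
    (⟨c, hc⟩ | hc) | (⟨c, hc⟩ | hc)
  · refine .inl ⟨c, ?_⟩
    filter_upwards [h, hU hc] with i h h'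
    rw [← h, add_comm] at h'
    exact add_left_cancel h'
  · refine .inr ?_
    filter_upwards [h, hU (hc a)] with i h h'
    rw [← h, add_comm] at h'
    exact lt_of_add_lt_add_right h'
  · refine .inl ⟨0, ?_⟩
    filter_upwards [h, hU hc] with i h h'
    rw [h', add_left_comm, add_eq_left, add_eq_zero] at h
    exact h.1
  · obtain ⟨i, h, h'⟩ := (h.and (hU (hc 0))).exists
    simp only [add_zero, ← h] at h'
    exact absurd le_add_self h'.not_ge

theorem canonicallyOrderedAdd_polySub :
    CanonicallyOrderedAdd (ResUlt U (polySub U)) := by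
  refine ResUlt.canonicallyOrderedAdd fun ⟨f, P, Q, h⟩ ⟨g, R, S, h'⟩ hfg => ?_
  have : ∀ i, ∃ d, f i ≤ g i → g i = f i + d := fun i => by
    by_cases hi : f i ≤ g i
    · obtain ⟨d, hd⟩ := exists_add_of_le hi
      exact ⟨d, fun _ => hd⟩
    · exact ⟨0, fun h => absurd h hi⟩
  choose d hd using this
  have hd' := hfg.mono fun i hi => hd i hi
  refine ⟨⟨d, R + Q, P + S, ?_⟩, hd'⟩
  filter_upwards [h, h', hd'] with i h h' hd
  rw [eval_add, eval_add, ← h, ← h', hd]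
  ring

open ResUlt

theorem exists_extension_of_paMinus :
    ∃ (K : Str) (e : Emb (str M) K), IsProper e ∧ IsEndExt e ∧ PAminus K := by
  let U := Ultrafilter.of (atTop : Filter M)
  have hU : (U : Filter M) ≤ atTop := Ultrafilter.of_le _
  have := canonicallyOrderedAdd_polySub (U := U)
  exact ⟨str (ResUlt U (polySub U)), emb U const_mem_polySub,
    isProper_emb _ id_mem_polySub fun a =>
      ((eventually_ge_atTop (a + 1)).filter_mono hU).mono fun i hi =>
        (lt_add_one a).trans_le hi,
    isEndExt_emb _ fun f hf a => eventually_const_or_lt_of_mem_polySub hU hf a, paminus_str⟩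

end Poly

/-- Theorem `thm:main`.
For every countable model `(M, 𝒳) ⊨ BΣ₂⁰ + WKL₀` there is a proper end
extension `(M, 𝒳) ≼_{e,Σ₂⁰} (K, 𝒳)` (with the same second-order part,
injected via `g`) such that `(K, 𝒳) ⊨ BΣ₁⁰`. -/
theorem statement_6 (S : Str) (X : Set (Set S.M))
    (hcM : Countable S.M) (hcX : X.Countable)
    (hB : BSigmaSO S X 2) (hW : WKL0 S X) :
    ∃ (K : Str) (e : Emb S K) (g : Set S.M → Set K.M),
      IsProper e ∧ IsEndExt e ∧
      (∀ A ∈ X, ∀ a : S.M, (e.j a ∈ g A ↔ a ∈ A)) ∧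
      (∀ φ : Fml, SigmaSO 2 φ →
        ∀ (v : ℕ → S.M) (w : ℕ → Set S.M), (∀ k, w k ∈ X) →
          (Sat S X v w φ ↔
            Sat K (g '' X) (fun k => e.j (v k)) (fun k => g (w k)) φ)) ∧
      BSigmaSO K (g '' X) 1 := by
  obtain ⟨M, _, _, _, _, _, rfl⟩ := exists_eq_str hB.1
  have : Countable M := hcM
  rcases X.eq_empty_or_nonempty with rfl | hne
  · obtain ⟨K, e, he, he', hK⟩ := exists_extension_of_paMinus (M := M)
    refine ⟨K, e, fun _ => ∅, he, he', fun A hA => absurd hA (Set.notMem_empty A),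
      fun _ _ _ w hw => absurd (hw 0) (Set.notMem_empty _), hK, ?_, ?_⟩
    all_goals
      rw [Set.image_empty]
      exact fun _ _ _ w hw => absurd (hw 0) (Set.notMem_empty _)
  · exact exists_extension_of_nonempty hcX hne hB hW

end PaperArith
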